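/- arXiv:1609.00710 — 6 statements merged into one kernel-verified Lean document; each statement's English description precedes it below -/
import Mathlib

section
/- For all μ ∈ ℝ, σ > 0, p ∈ (0,1), α ≠ 0 and y ∈ ℝ, the double mixture integral ∫₀^∞ ∫₀^∞ (2πσ²Bw)^{-1/2} exp(−(y − μ − σαs − σAw)²/(2σ²Bw)) · exp(−w) · √(2/π) exp(−s²/2) dw ds, with A = (1−2p)/(p(1−p)) and B = 2/(p(1−p)), equals the GAL(μ,σ,p,α) density f(y). That is, the hierarchical representation Y = μ + σαS + σAW + σ(BW)^{1/2}U with W ~ Exp(1), S ~ half-normal N⁺(0,1), U ~ N(0,1) independent, has density f. -/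
open MeasureTheory Real Set

/-- Standard normal CDF. -/
noncomputable def Phi (x : ℝ) : ℝ :=
  ∫ t in Set.Iic x, (Real.sqrt (2 * Real.pi))⁻¹ * Real.exp (-t ^ 2 / 2)

/-- The GAL(μ,σ,p,α) probability density function. -/
noncomputable def galPdf (μ σ p α y : ℝ) : ℝ :=
  let ys := (y - μ) / σ
  let pp := p - (if 0 < α then 1 else 0)
  let pm := p - (if α < 0 then 1 else 0)
  (2 * p * (1 - p) / σ) *
    ((Phi (ys / α - α * pm) - Phi (-(α * pm))) *
        Real.exp (-(ys * pm) + (α * pm) ^ 2 / 2) *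
        (if 0 < ys / α then 1 else 0) +
      Phi (α * pp - ys / α * (if 0 < ys / α then 1 else 0)) *
        Real.exp (-(ys * pp) + (α * pp) ^ 2 / 2))

open Filter Topology ProbabilityTheory

lemma integrable_std_gaussian :
    Integrable (fun t : ℝ => (√(2 * π))⁻¹ * exp (-t ^ 2 / 2)) := by
  simpa [gaussianPDFReal_def] using integrable_gaussianPDFReal 0 1

lemma integral_std_gaussian :
    ∫ t : ℝ, (√(2 * π))⁻¹ * exp (-t ^ 2 / 2) = 1 := by
  simpa [gaussianPDFReal_def] using integral_gaussianPDFReal_eq_one 0 one_ne_zero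

lemma Phi_neg (x : ℝ) : Phi (-x) = 1 - Phi x := by
  have h := intervalIntegral.integral_Iic_add_Ioi (b := x)
    integrable_std_gaussian.integrableOn integrable_std_gaussian.integrableOn
  have h' := integral_comp_neg_Iic (-x) (fun t : ℝ => (√(2 * π))⁻¹ * exp (-t ^ 2 / 2))
  simp only [neg_sq, neg_neg] at h'
  rw [integral_std_gaussian] at h
  unfold Phi
  linarith

lemma Phi_zero : Phi 0 = 1 / 2 := by
  have h := Phi_neg 0
  rw [neg_zero] at h
  linarith

lemma hasDerivAt_Phi (x : ℝ) :
    HasDerivAt Phi ((√(2 * π))⁻¹ * exp (-x ^ 2 / 2)) x := by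
  have hc : Continuous (fun t : ℝ => (√(2 * π))⁻¹ * exp (-t ^ 2 / 2)) := by fun_prop
  have h : Phi = fun y => (∫ t in (0 : ℝ)..y, (√(2 * π))⁻¹ * exp (-t ^ 2 / 2)) + Phi 0 := by
    funext y
    rw [← intervalIntegral.integral_Iic_sub_Iic integrable_std_gaussian.integrableOn
      integrable_std_gaussian.integrableOn]
    simp [Phi]
  rw [h]
  exact (intervalIntegral.integral_hasDerivAt_right (hc.intervalIntegrable _ _)
    (hc.stronglyMeasurableAtFilter _ _) hc.continuousAt).add_const _

lemma tendsto_Phi_atTop : Tendsto Phi atTop (𝓝 1) := by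
  have h := tendsto_setIntegral_of_monotone (μ := volume) (s := fun x : ℝ => Iic x)
    (fun _ => measurableSet_Iic) (fun _ _ h => Iic_subset_Iic.2 h)
    (f := fun t : ℝ => (√(2 * π))⁻¹ * exp (-t ^ 2 / 2))
    integrable_std_gaussian.integrableOn
  rwa [iUnion_Iic, setIntegral_univ, integral_std_gaussian] at h

lemma tendsto_Phi_atBot : Tendsto Phi atBot (𝓝 0) := by
  have h := (tendsto_Phi_atTop.comp tendsto_neg_atBot_atTop).const_sub 1
  simpa [Function.comp_def, Phi_neg] using h

lemma hasDerivAt_Phi_sqrt_add (a b : ℝ) {w : ℝ} (hw : 0 < w) :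
    HasDerivAt (fun w => Phi (a * √w + b / √w))
      ((√(2 * π))⁻¹ * exp (-(a * w + b) ^ 2 / (2 * w)) * ((a - b / w) / (2 * √w))) w := by
  have hr : 0 < √w := sqrt_pos.2 hw
  have hs := hasDerivAt_sqrt hw.ne'
  have h := (hasDerivAt_Phi (a * √w + b / √w)).comp w
    ((hs.const_mul a).add ((hasDerivAt_const w b).div hs hr.ne'))
  convert! h using 1
  have hsq := sq_sqrt hw.le
  generalize √w = r at *
  subst hsq
  have e : -(a * r ^ 2 + b) ^ 2 / (2 * r ^ 2) = -(a * r + b / r) ^ 2 / 2 := by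
    field_simp
  rw [e]
  field_simp
  ring

lemma integral_hitting_kernel {a b : ℝ} (ha : 0 < a) (hb : 0 ≤ b) :
    ∫ w in Ioi (0 : ℝ), (√(2 * π * w))⁻¹ * exp (-(a * w - b) ^ 2 / (2 * w)) = 1 / a := by
  set G : ℝ → ℝ := fun w => (exp (2 * a * b) * Phi (a * √w + b / √w) +
    Phi (a * √w + (-b) / √w)) / a with hG
  have hsqrt : Tendsto (fun w : ℝ => √w) atTop atTop := tendsto_sqrt_atTop
  have hlin : ∀ c : ℝ, Tendsto (fun w : ℝ => a * √w + c / √w) atTop atTop := fun c =>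
    (hsqrt.const_mul_atTop ha).atTop_add (hsqrt.const_div_atTop c)
  have htop : Tendsto G atTop (𝓝 ((exp (2 * a * b) * 1 + 1) / a)) :=
    (((tendsto_Phi_atTop.comp (hlin b)).const_mul _).add
      (tendsto_Phi_atTop.comp (hlin (-b)))).div_const a
  have hzero : Tendsto G (𝓝[>] 0) (𝓝 (exp (2 * a * b) / a)) := by
    have hs0 : Tendsto (fun w : ℝ => √w) (𝓝[>] 0) (𝓝[>] 0) := by
      refine tendsto_nhdsWithin_iff.2 ⟨?_, ?_⟩
      · simpa using (continuous_sqrt.tendsto (0 : ℝ)).mono_left nhdsWithin_le_nhds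
      · filter_upwards [self_mem_nhdsWithin] with w hw using sqrt_pos.2 hw
    have hs1 : Tendsto (fun w : ℝ => a * √w) (𝓝[>] 0) (𝓝 0) := by
      simpa using (hs0.mono_right nhdsWithin_le_nhds).const_mul a
    have hinv : Tendsto (fun w : ℝ => (√w)⁻¹) (𝓝[>] 0) atTop :=
      tendsto_inv_nhdsGT_zero.comp hs0
    rcases hb.eq_or_lt with rfl | hb
    · have h := ((hasDerivAt_Phi 0).continuousAt.tendsto.comp hs1)
      have h2 := ((h.const_mul (exp (2 * a * 0))).add h).div_const a
      convert! h2 using 2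
      · simp [hG]
      · simp [Phi_zero]; ring
    · have h1 : Tendsto (fun w : ℝ => a * √w + b / √w) (𝓝[>] 0) atTop :=
        hs1.add_atTop (hinv.const_mul_atTop hb)
      have h2 : Tendsto (fun w : ℝ => a * √w + (-b) / √w) (𝓝[>] 0) atBot :=
        hs1.add_atBot (hinv.const_mul_atTop_of_neg (neg_lt_zero.2 hb))
      simpa using (((tendsto_Phi_atTop.comp h1).const_mul (exp (2 * a * b))).add
        (tendsto_Phi_atBot.comp h2)).div_const a
  have hderiv : ∀ w ∈ Ioi (0 : ℝ), HasDerivAt (Function.update G 0 (exp (2 * a * b) / a))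
      ((√(2 * π * w))⁻¹ * exp (-(a * w - b) ^ 2 / (2 * w))) w := by
    intro w hw
    have hw : 0 < w := hw
    have h := (((hasDerivAt_Phi_sqrt_add a b hw).const_mul (exp (2 * a * b))).add
      (hasDerivAt_Phi_sqrt_add a (-b) hw)).div_const a
    have h' : HasDerivAt G ((√(2 * π * w))⁻¹ * exp (-(a * w - b) ^ 2 / (2 * w))) w := by
      convert! h using 1
      have e : exp (-(a * w - b) ^ 2 / (2 * w)) =
          exp (2 * a * b) * exp (-(a * w + b) ^ 2 / (2 * w)) := by
        rw [← exp_add]; congr 1; field_simp; ring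
      rw [← sub_eq_add_neg, ← mul_assoc, mul_left_comm (exp _), ← e,
        sqrt_mul (by positivity) w]
      have := sqrt_pos.2 hw
      field_simp
      ring
    refine h'.congr_of_eventuallyEq ?_
    filter_upwards [isOpen_ne.mem_nhds hw.ne'] with x hx using Function.update_of_ne hx _ _
  have hcont : ContinuousWithinAt (Function.update G 0 (exp (2 * a * b) / a)) (Ici 0) 0 := by
    rw [continuousWithinAt_update_same, Ici_sdiff_left]
    exact hzero
  have htop' : Tendsto (Function.update G 0 (exp (2 * a * b) / a)) atTop
      (𝓝 ((exp (2 * a * b) * 1 + 1) / a)) := by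
    refine htop.congr' ?_
    filter_upwards [eventually_ne_atTop 0] with x hx using (Function.update_of_ne hx _ _).symm
  rw [integral_Ioi_of_hasDerivAt_of_nonneg hcont hderiv (fun w _ => by positivity) htop']
  simp only [Function.update_self]
  ring

/-- The exponential scale mixture of normals is the asymmetric Laplace density. -/
lemma integral_exponential_mixture {σ p : ℝ} (hσ : 0 < σ) (hp : p ∈ Ioo (0 : ℝ) 1) (u : ℝ) :
    ∫ w in Ioi (0 : ℝ), (√(2 * π * σ ^ 2 * (2 / (p * (1 - p))) * w))⁻¹ *
      exp (-(σ * u - σ * ((1 - 2 * p) / (p * (1 - p))) * w) ^ 2 /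
        (2 * σ ^ 2 * (2 / (p * (1 - p))) * w)) * exp (-w) =
    p * (1 - p) / σ * exp (-|u| / 2 + u * (1 - 2 * p) / 2) := by
  have hp0 : 0 < p := hp.1
  have hp1 : 0 < 1 - p := sub_pos.2 hp.2
  obtain ⟨a, ha, haq⟩ : ∃ a : ℝ, 0 < a ∧ 2 / (p * (1 - p)) = (2 * a) ^ 2 := by
    refine ⟨√(2 / (p * (1 - p))) / 2, by positivity, ?_⟩
    rw [mul_div_cancel₀ _ two_ne_zero, sq_sqrt (by positivity)]
  have haq' : 2 * a ^ 2 * (p * (1 - p)) = 1 := by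
    field_simp at haq
    linarith
  have key : ∀ w ∈ Ioi (0 : ℝ), (√(2 * π * σ ^ 2 * (2 / (p * (1 - p))) * w))⁻¹ *
      exp (-(σ * u - σ * ((1 - 2 * p) / (p * (1 - p))) * w) ^ 2 /
        (2 * σ ^ 2 * (2 / (p * (1 - p))) * w)) * exp (-w) =
      (1 / (2 * a * σ) * exp (-|u| / 2 + u * (1 - 2 * p) / 2)) *
        ((√(2 * π * w))⁻¹ * exp (-(a * w - |u| / (2 * a)) ^ 2 / (2 * w))) := by
    intro w hw
    have hw : 0 < w := hw
    have hs : √(2 * π * σ ^ 2 * (2 / (p * (1 - p))) * w) = 2 * a * σ * √(2 * π * w) := by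
      rw [haq, show 2 * π * σ ^ 2 * (2 * a) ^ 2 * w = (2 * a * σ) ^ 2 * (2 * π * w) by ring,
        sqrt_mul (by positivity), sqrt_sq (by positivity)]
    have he : -(σ * u - σ * ((1 - 2 * p) / (p * (1 - p))) * w) ^ 2 /
        (2 * σ ^ 2 * (2 / (p * (1 - p))) * w) + -w =
        (-|u| / 2 + u * (1 - 2 * p) / 2) + -(a * w - |u| / (2 * a)) ^ 2 / (2 * w) := by
      have h1 : (1 - 2 * p) / (p * (1 - p)) = (1 - 2 * p) * (2 * a ^ 2) := by
        rw [div_eq_iff (by positivity), mul_assoc, haq', mul_one]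
      have h2 : -(a * w - |u| / (2 * a)) ^ 2 / (2 * w) =
          -(a ^ 2 * w) / 2 + |u| / 2 - u ^ 2 / (8 * a ^ 2 * w) := by
        rw [← sq_abs u]; field_simp; ring
      rw [h1, h2, haq]
      field_simp
      linear_combination (64 * a ^ 2 * w ^ 2) * haq'
    rw [hs, mul_assoc, ← exp_add, he, exp_add, mul_inv]
    ring
  rw [setIntegral_congr_fun measurableSet_Ioi key, integral_const_mul,
    integral_hitting_kernel ha (by positivity)]
  have : 1 / (2 * a * σ) * (1 / a) = p * (1 - p) / σ := by
    field_simp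
    linarith
  rw [← this]
  ring

lemma hasDerivAt_halfNormal_tilt (c k s : ℝ) :
    HasDerivAt (fun s => 2 * exp (c + k ^ 2 / 2) * Phi (s - k))
      (exp (c + k * s) * (√(2 / π) * exp (-s ^ 2 / 2))) s := by
  have h := ((hasDerivAt_Phi (s - k)).comp s ((hasDerivAt_id s).sub_const k)).const_mul
    (2 * exp (c + k ^ 2 / 2))
  convert! h using 1
  have e : exp (c + k * s) * exp (-s ^ 2 / 2) =
      exp (c + k ^ 2 / 2) * exp (-(s - k) ^ 2 / 2) := by
    rw [← exp_add, ← exp_add]; congr 1; ring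
  have hc : √(2 / π) = 2 * (√(2 * π))⁻¹ := by
    rw [sqrt_div (by norm_num), sqrt_mul (by norm_num)]
    have := sq_sqrt (show (0 : ℝ) ≤ 2 by norm_num)
    have : 0 < √π := sqrt_pos.2 pi_pos
    field_simp
    linarith
  rw [hc]
  linear_combination 2 * (√(2 * π))⁻¹ * e

lemma tendsto_halfNormal_tilt (c k : ℝ) :
    Tendsto (fun s => 2 * exp (c + k ^ 2 / 2) * Phi (s - k)) atTop
      (𝓝 (2 * exp (c + k ^ 2 / 2) * 1)) :=
  (tendsto_Phi_atTop.comp (tendsto_atTop_add_const_right _ (-k) tendsto_id)).const_mul _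

lemma integrableOn_halfNormal_tilt (c k M : ℝ) :
    IntegrableOn (fun s => exp (c + k * s) * (√(2 / π) * exp (-s ^ 2 / 2))) (Ioi M) :=
  integrableOn_Ioi_deriv_of_nonneg' (fun s _ => hasDerivAt_halfNormal_tilt c k s)
    (fun s _ => by positivity) (tendsto_halfNormal_tilt c k)

lemma integral_Ioi_halfNormal_tilt (c k M : ℝ) :
    ∫ s in Ioi M, exp (c + k * s) * (√(2 / π) * exp (-s ^ 2 / 2)) =
      2 * exp (c + k ^ 2 / 2) * Phi (k - M) := by
  rw [integral_Ioi_of_hasDerivAt_of_nonneg' (fun s _ => hasDerivAt_halfNormal_tilt c k s)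
    (fun s _ => by positivity) (tendsto_halfNormal_tilt c k), ← neg_sub M k, Phi_neg]
  ring

lemma integral_Ioc_halfNormal_tilt (c k : ℝ) {M : ℝ} (hM : 0 ≤ M) :
    ∫ s in Ioc 0 M, exp (c + k * s) * (√(2 / π) * exp (-s ^ 2 / 2)) =
      2 * exp (c + k ^ 2 / 2) * (Phi (M - k) - Phi (-k)) := by
  rw [← intervalIntegral.integral_of_le hM,
    intervalIntegral.integral_eq_sub_of_hasDerivAt
      (fun s _ => hasDerivAt_halfNormal_tilt c k s)
      (Continuous.intervalIntegrable (by fun_prop) _ _)]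
  rw [zero_sub]
  ring

lemma integral_halfNormal_piecewise {F : ℝ → ℝ} {c₁ k₁ c₂ k₂ m : ℝ}
    (h₁ : ∀ s ≤ m, F s = exp (c₁ + k₁ * s)) (h₂ : ∀ s, m ≤ s → F s = exp (c₂ + k₂ * s)) :
    ∫ s in Ioi (0 : ℝ), F s * (√(2 / π) * exp (-s ^ 2 / 2)) =
      2 * ((Phi (m - k₁) - Phi (-k₁)) * exp (c₁ + k₁ ^ 2 / 2) * (if 0 < m then 1 else 0) +
        Phi (k₂ - m * (if 0 < m then 1 else 0)) * exp (c₂ + k₂ ^ 2 / 2)) := by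
  split_ifs with hm
  · have e₁ : EqOn (fun s => F s * (√(2 / π) * exp (-s ^ 2 / 2)))
        (fun s => exp (c₁ + k₁ * s) * (√(2 / π) * exp (-s ^ 2 / 2))) (Ioc 0 m) :=
      fun s hs => by simp only [h₁ s hs.2]
    have e₂ : EqOn (fun s => F s * (√(2 / π) * exp (-s ^ 2 / 2)))
        (fun s => exp (c₂ + k₂ * s) * (√(2 / π) * exp (-s ^ 2 / 2))) (Ioi m) :=
      fun s hs => by simp only [h₂ s (le_of_lt hs)]
    rw [← Ioc_union_Ioi_eq_Ioi hm.le, setIntegral_union Ioc_disjoint_Ioi_same measurableSet_Ioi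
      (((integrableOn_halfNormal_tilt c₁ k₁ 0).mono_set Ioc_subset_Ioi_self).congr_fun
        e₁.symm measurableSet_Ioc)
      ((integrableOn_halfNormal_tilt c₂ k₂ m).congr_fun e₂.symm measurableSet_Ioi),
      setIntegral_congr_fun measurableSet_Ioc e₁, setIntegral_congr_fun measurableSet_Ioi e₂,
      integral_Ioc_halfNormal_tilt _ _ hm.le, integral_Ioi_halfNormal_tilt, mul_one]
    ring_nf
  · have e₂ : EqOn (fun s => F s * (√(2 / π) * exp (-s ^ 2 / 2)))
        (fun s => exp (c₂ + k₂ * s) * (√(2 / π) * exp (-s ^ 2 / 2))) (Ioi 0) :=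
      fun s hs => by simp only [h₂ s ((not_lt.1 hm).trans (le_of_lt hs))]
    rw [setIntegral_congr_fun measurableSet_Ioi e₂, integral_Ioi_halfNormal_tilt, mul_zero]
    ring_nf

/-- The hierarchical normal–exponential–half-normal mixture representation
integrates to the GAL density. -/
theorem gal_mixture_representation (μ σ p α y : ℝ) (hσ : 0 < σ)
    (hp : p ∈ Set.Ioo (0 : ℝ) 1) (hα : α ≠ 0) :
    (∫ s in Set.Ioi (0 : ℝ), ∫ w in Set.Ioi (0 : ℝ),
        (Real.sqrt (2 * Real.pi * σ ^ 2 * (2 / (p * (1 - p))) * w))⁻¹ *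
          Real.exp (-(y - μ - σ * α * s - σ * ((1 - 2 * p) / (p * (1 - p))) * w) ^ 2 /
            (2 * σ ^ 2 * (2 / (p * (1 - p))) * w)) *
          Real.exp (-w) * (Real.sqrt (2 / Real.pi) * Real.exp (-s ^ 2 / 2))) =
      galPdf μ σ p α y := by
  have hsum : ∀ s : ℝ, (∫ w in Ioi (0 : ℝ),
        (√(2 * π * σ ^ 2 * (2 / (p * (1 - p))) * w))⁻¹ *
          exp (-(y - μ - σ * α * s - σ * ((1 - 2 * p) / (p * (1 - p))) * w) ^ 2 /
            (2 * σ ^ 2 * (2 / (p * (1 - p))) * w)) *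
          exp (-w) * (√(2 / π) * exp (-s ^ 2 / 2))) =
      p * (1 - p) / σ * (exp (-|α * ((y - μ) / σ / α - s)| / 2 +
        α * ((y - μ) / σ / α - s) * (1 - 2 * p) / 2) * (√(2 / π) * exp (-s ^ 2 / 2))) := by
    intro s
    rw [integral_mul_const, ← mul_assoc (p * (1 - p) / σ), ← integral_exponential_mixture hσ hp]
    have e : σ * (α * ((y - μ) / σ / α - s)) = y - μ - σ * α * s := by
      field_simp
    rw [e]
  simp only [hsum]
  rw [integral_const_mul]
  simp only [galPdf]
  generalize hys : (y - μ) / σ = z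
  generalize hpp : p - (if 0 < α then 1 else 0) = pp
  generalize hpm : p - (if α < 0 then 1 else 0) = pm
  have hmz : α * (z / α) = z := mul_div_cancel₀ _ hα
  rw [integral_halfNormal_piecewise (m := z / α) (c₁ := -(z * pm)) (k₁ := α * pm)
    (c₂ := -(z * pp)) (k₂ := α * pp)]
  · ring
  · intro s hs
    congr 1
    rcases hα.lt_or_gt with h | h
    · rw [abs_of_nonpos (mul_nonpos_of_nonpos_of_nonneg h.le (sub_nonneg.2 hs)), ← hpm, if_pos h]
      linear_combination (1 - p) * hmz
    · rw [abs_of_nonneg (mul_nonneg h.le (sub_nonneg.2 hs)), ← hpm, if_neg h.not_gt]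
      linear_combination -p * hmz
  · intro s hs
    congr 1
    rcases hα.lt_or_gt with h | h
    · rw [abs_of_nonneg (mul_nonneg_of_nonpos_of_nonpos h.le (sub_nonpos.2 hs)), ← hpp,
        if_neg h.not_gt]
      linear_combination -p * hmz
    · rw [abs_of_nonpos (mul_nonpos_of_nonneg_of_nonpos h.le (sub_nonpos.2 hs)), ← hpp, if_pos h]
      linear_combination (1 - p) * hmz
end

section
/- For all a ∈ ℝ, c > 0 and b, y ∈ ℝ, the normal–exponential mixture integral satisfies ∫₀^∞ (2πw)^{−1/2} exp( −(y − b − aw)²/(2cw) − w ) dw = √(c/(a² + 2c)) · exp( (a(y − b) − √(a² + 2c)·|y − b|)/c ). -/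
open MeasureTheory Real Set

lemma integral_eq_zero_of_odd {f : ℝ → ℝ} (hf : ∀ x, f (-x) = -f x) : ∫ x, f x = 0 := by
  have h := integral_neg_eq_self f volume
  simp only [hf, integral_neg] at h
  linarith

/-- The Cauchy–Schlömilch substitution for the Gaussian, in the variable `w = x ^ 2`. -/
lemma integral_inv_sqrt_mul_exp_neg_sq_of_pos {p q : ℝ} (hp : 0 < p) (hq : 0 < q) :
    ∫ w in Ioi (0 : ℝ), (√w)⁻¹ * exp (-(p * √w - q / √w) ^ 2) = √π / p := by
  let R : ℝ → ℝ := fun u ↦ √(u ^ 2 + 4 * p * q)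
  have hRsq (u : ℝ) : R u ^ 2 = u ^ 2 + 4 * p * q := sq_sqrt (by positivity)
  have hR (u : ℝ) : 0 < R u := sqrt_pos.2 (by positivity)
  have hRabs (u : ℝ) : |u| < R u := by
    refine abs_lt_of_sq_lt_sq ?_ (hR u).le
    rw [hRsq]
    have := mul_pos hp hq
    linarith
  let X : ℝ → ℝ := fun u ↦ (u + R u) / (2 * p)
  have hX (u : ℝ) : 0 < X u := by
    have := (abs_lt.1 (hRabs u)).1
    exact div_pos (by linarith) (by positivity)
  have hXu (u : ℝ) : p * X u - q / X u = u := by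
    have h : p * X u ^ 2 - u * X u - q = 0 := by
      simp only [X]
      field_simp
      linear_combination hRsq u
    have := (hX u).ne'
    field_simp
    linear_combination h
  have hsqrt (u : ℝ) : √(X u ^ 2) = X u := sqrt_sq (hX u).le
  have hX' (u : ℝ) : HasDerivAt X ((1 + u / R u) / (2 * p)) u := by
    have h : HasDerivAt R (u / R u) u := by
      have hne : u ^ 2 + 4 * p * q ≠ 0 := by positivity
      have h := ((hasDerivAt_pow 2 u).add_const (4 * p * q)).sqrt hne
      have hval : ((2 : ℕ) : ℝ) * u ^ (2 - 1) / (2 * √(u ^ 2 + 4 * p * q)) = u / R u := by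
        simp [R, mul_div_mul_left]
      rwa [hval] at h
    exact ((hasDerivAt_id u).add h).div_const _
  have himage : (fun u ↦ X u ^ 2) '' univ = Ioi 0 := by
    ext w
    simp only [image_univ, mem_range, mem_Ioi]
    refine ⟨fun ⟨u, hu⟩ ↦ hu ▸ pow_pos (hX u) 2, fun hw ↦ ⟨p * √w - q / √w, ?_⟩⟩
    have hw' : 0 < √w := sqrt_pos.2 hw
    have h : R (p * √w - q / √w) = p * √w + q / √w := by
      simp only [R]
      rw [sqrt_eq_iff_mul_self_eq_of_pos (by positivity)]
      field_simp
      ring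
    have : X (p * √w - q / √w) = √w := by
      simp only [X, h]
      field_simp
      ring
    rw [this, sq_sqrt hw.le]
  have hinj : InjOn (fun u ↦ X u ^ 2) univ := by
    intro u _ v _ h
    have h' : X u = X v := by rw [← hsqrt u, ← hsqrt v]; exact congrArg sqrt h
    rw [← hXu u, ← hXu v, h']
  have hratio (u : ℝ) : |u / R u| ≤ 1 := by
    rw [abs_div, abs_of_pos (hR u), div_le_one (hR u)]
    exact (hRabs u).le
  have hgauss : Integrable fun u : ℝ ↦ exp (-u ^ 2) := by
    simpa using integrable_exp_neg_mul_sq one_pos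
  have hodd : Integrable fun u : ℝ ↦ u / R u * exp (-u ^ 2) := by
    refine hgauss.bdd_mul (c := 1) ?_ (.of_forall hratio)
    exact (by fun_prop : Measurable fun u : ℝ ↦ u / √(u ^ 2 + 4 * p * q)).aestronglyMeasurable
  rw [← himage, integral_image_eq_integral_abs_deriv_smul (f := fun u ↦ X u ^ 2) MeasurableSet.univ
    (fun u _ ↦ ((hX' u).pow 2).hasDerivWithinAt) hinj]
  have hcongr (u : ℝ) : |((2 : ℕ) : ℝ) * X u ^ (2 - 1) * ((1 + u / R u) / (2 * p))| •
      ((√(X u ^ 2))⁻¹ * exp (-(p * √(X u ^ 2) - q / √(X u ^ 2)) ^ 2)) =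
      p⁻¹ * (exp (-u ^ 2) + u / R u * exp (-u ^ 2)) := by
    have hnn : 0 ≤ 1 + u / R u := by linarith [(abs_le.1 (hratio u)).1]
    have hXpos := hX u
    rw [abs_of_nonneg (by positivity), hsqrt, hXu, smul_eq_mul]
    have : X u * (X u)⁻¹ = 1 := mul_inv_cancel₀ hXpos.ne'
    have hp2 : (1 + u / R u) / (2 * p) = p⁻¹ * (1 + u / R u) / 2 := by field_simp
    rw [hp2]
    push_cast
    linear_combination (p⁻¹ * (1 + u / R u) * exp (-u ^ 2)) * this
  simp only [Measure.restrict_univ, hcongr]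
  rw [integral_const_mul, integral_add hgauss hodd,
    integral_eq_zero_of_odd (f := fun u ↦ u / R u * exp (-u ^ 2))
      (fun u ↦ by simp [R, neg_div])]
  have := integral_gaussian 1
  simp only [neg_mul, one_mul, div_one] at this
  rw [this]
  ring

lemma integral_inv_sqrt_mul_exp_neg_sq {p q : ℝ} (hp : 0 < p) (hq : 0 ≤ q) :
    ∫ w in Ioi (0 : ℝ), (√w)⁻¹ * exp (-(p * √w - q / √w) ^ 2) = √π / p := by
  obtain rfl | hq := hq.eq_or_lt
  · have h := integral_rpow_mul_exp_neg_mul_Ioi (a := 1 / 2) (r := p ^ 2) (by norm_num)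
      (by positivity)
    rw [Gamma_one_half_eq, ← sqrt_eq_rpow (1 / p ^ 2), one_div (p ^ 2), sqrt_inv, sqrt_sq hp.le] at h
    rw [div_eq_inv_mul, ← h]
    refine setIntegral_congr_fun measurableSet_Ioi fun w (hw : 0 < w) ↦ ?_
    simp only [zero_div, sub_zero, mul_pow, sq_sqrt hw.le]
    rw [sqrt_eq_rpow, ← rpow_neg hw.le]
    norm_num
  · exact integral_inv_sqrt_mul_exp_neg_sq_of_pos hp hq

/-- The normal–exponential mixture integral in closed form. -/
theorem normal_exponential_mixture (a c b y : ℝ) (hc : 0 < c) :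
    (∫ w in Set.Ioi (0 : ℝ),
        (Real.sqrt (2 * Real.pi * w))⁻¹ *
          Real.exp (-(y - b - a * w) ^ 2 / (2 * c * w) - w)) =
      Real.sqrt (c / (a ^ 2 + 2 * c)) *
        Real.exp ((a * (y - b) - Real.sqrt (a ^ 2 + 2 * c) * |y - b|) / c) := by
  generalize y - b = d
  set s := √(a ^ 2 + 2 * c) with hs
  have hspos : 0 < s := sqrt_pos.2 (by positivity)
  have hssq : s ^ 2 = a ^ 2 + 2 * c := sq_sqrt (by positivity)
  have hk : 0 < √(2 * c) := sqrt_pos.2 (by positivity)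
  have hksq : √(2 * c) ^ 2 = 2 * c := sq_sqrt (by positivity)
  have key := integral_inv_sqrt_mul_exp_neg_sq (p := s / √(2 * c)) (q := |d| / √(2 * c))
    (by positivity) (by positivity)
  have hcongr : ∀ w ∈ Ioi (0 : ℝ),
      (√(2 * π * w))⁻¹ * exp (-(d - a * w) ^ 2 / (2 * c * w) - w) =
      (√(2 * π))⁻¹ * exp ((a * d - s * |d|) / c) *
        ((√w)⁻¹ * exp (-(s / √(2 * c) * √w - |d| / √(2 * c) / √w) ^ 2)) := by
    intro w hw
    rw [mem_Ioi] at hw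
    have hw' : 0 < √w := sqrt_pos.2 hw
    have hexp : -(d - a * w) ^ 2 / (2 * c * w) - w = (a * d - s * |d|) / c +
        -(s / √(2 * c) * √w - |d| / √(2 * c) / √w) ^ 2 := by
      have h : (s / √(2 * c) * √w - |d| / √(2 * c) / √w) ^ 2 =
          (s ^ 2 * w - 2 * s * |d| + d ^ 2 / w) / (2 * c) := by
        have expand (k t : ℝ) (hk : 0 < k) (ht : 0 < t) : (s / k * t - |d| / k / t) ^ 2 =
            (s ^ 2 * t ^ 2 - 2 * s * |d| + |d| ^ 2 / t ^ 2) / k ^ 2 := by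
          field_simp
          ring
        rw [expand _ _ hk hw', hksq, sq_sqrt hw.le, sq_abs]
      rw [h, hssq]
      field_simp
      ring
    rw [hexp, exp_add, sqrt_mul (by positivity), mul_inv]
    ring
  rw [setIntegral_congr_fun measurableSet_Ioi hcongr, integral_const_mul, key,
    sqrt_div hc.le, ← hs, sqrt_mul zero_le_two, sqrt_mul zero_le_two]
  field_simp
end

section
/- For all μ ∈ ℝ, σ > 0, p ∈ (0,1) and y ∈ ℝ, with A = (1−2p)/(p(1−p)) and B = 2/(p(1−p)), the normal–exponential mixture equals the asymmetric Laplace density: ∫₀^∞ (2πσ²Bw)^{−1/2} exp( −(y − μ − σAw)²/(2σ²Bw) ) · exp(−w) dw = (p(1−p)/σ) · exp( −((y − μ)/σ)·(p − 1{y < μ}) ). -/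
open MeasureTheory Real Set

/-- The substitution `u = a x - b / x` maps the positive half-line bijectively onto `ℝ`. -/
theorem bijOn_mul_sub_div {a b : ℝ} (ha : 0 < a) (hb : 0 < b) :
    BijOn (fun x : ℝ => a * x - b / x) (Ioi 0) univ := by
  have hmono : StrictMonoOn (fun x : ℝ => a * x - b / x) (Ioi 0) := by
    intro x hx z hz hxz
    have hx' : 0 < x := hx
    have h₁ : a * x < a * z := by gcongr
    have h₂ : b / z < b / x := by gcongr
    simp only
    linarith
  refine ⟨mapsTo_univ _ _, hmono.injOn, fun u _ => ?_⟩
  have hs : √(u ^ 2 + 4 * a * b) ^ 2 = u ^ 2 + 4 * a * b := sq_sqrt (by positivity)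
  have hpos : 0 < u + √(u ^ 2 + 4 * a * b) := by
    have : |u| < √(u ^ 2 + 4 * a * b) := by
      rw [← sqrt_sq_eq_abs]
      exact sqrt_lt_sqrt (sq_nonneg u) (by nlinarith [mul_pos ha hb])
    linarith [neg_abs_le u]
  refine ⟨(u + √(u ^ 2 + 4 * a * b)) / (2 * a), div_pos hpos (by positivity), ?_⟩
  generalize √(u ^ 2 + 4 * a * b) = r at hs hpos
  have := hpos.ne'
  simp only
  field_simp
  linear_combination hs

theorem hasDerivAt_mul_sub_div (a b : ℝ) {x : ℝ} (hx : x ≠ 0) :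
    HasDerivAt (fun x : ℝ => a * x - b / x) (a + b / x ^ 2) x := by
  have h := ((hasDerivAt_id x).const_mul a).sub ((hasDerivAt_inv hx).const_mul b)
  refine (h.congr_deriv (by field_simp; ring)).congr_of_eventuallyEq (.of_forall fun z => ?_)
  simp [div_eq_mul_inv]

theorem integral_exp_neg_mul_sub_div_sq {a b : ℝ} (ha : 0 < a) (hb : 0 < b) :
    ∫ x in Ioi (0 : ℝ), exp (-(a * x - b / x) ^ 2) = √π / (2 * a) := by
  have hbij := bijOn_mul_sub_div ha hb
  have hderiv : ∀ x ∈ Ioi (0 : ℝ),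
      HasDerivWithinAt (fun x : ℝ => a * x - b / x) (a + b / x ^ 2) (Ioi 0) x :=
    fun x hx => (hasDerivAt_mul_sub_div a b (ne_of_gt hx)).hasDerivWithinAt
  have hgauss : Integrable (fun u : ℝ => exp (-u ^ 2)) := by
    simpa using integrable_exp_neg_mul_sq one_pos
  have hint : IntegrableOn
      (fun x => |a + b / x ^ 2| • exp (-(a * x - b / x) ^ 2)) (Ioi 0) := by
    rw [← integrableOn_image_iff_integrableOn_abs_deriv_smul measurableSet_Ioi hderiv
      hbij.injOn (fun u => exp (-u ^ 2)), hbij.image_eq]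
    exact hgauss.integrableOn
  have htotal : ∫ x in Ioi (0 : ℝ), |a + b / x ^ 2| • exp (-(a * x - b / x) ^ 2) = √π := by
    rw [← integral_image_eq_integral_abs_deriv_smul measurableSet_Ioi hderiv
      hbij.injOn (fun u => exp (-u ^ 2)), hbij.image_eq, setIntegral_univ]
    simpa using integral_gaussian 1
  have hint₁ : IntegrableOn (fun x => a * exp (-(a * x - b / x) ^ 2)) (Ioi 0) := by
    refine Integrable.mono' hint (by fun_prop) (.of_forall fun x => ?_)
    have : 0 ≤ b / x ^ 2 := by positivity
    rw [norm_of_nonneg (by positivity), abs_of_nonneg (by positivity), smul_eq_mul]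
    gcongr
    linarith
  have hint₂ : IntegrableOn (fun x => b / x ^ 2 * exp (-(a * x - b / x) ^ 2)) (Ioi 0) := by
    refine (hint.sub hint₁).congr (.of_forall fun x => ?_)
    have : 0 ≤ b / x ^ 2 := by positivity
    simp only [Pi.sub_apply, smul_eq_mul]
    rw [abs_of_nonneg (by positivity)]
    ring
  have himage : (fun x : ℝ => b / (a * x)) '' Ioi 0 = Ioi 0 := by
    ext z
    constructor
    · rintro ⟨x, hx, rfl⟩
      exact div_pos hb (mul_pos ha hx)
    · intro (hz : 0 < z)
      exact ⟨b / (a * z), div_pos hb (mul_pos ha hz), by field_simp⟩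
  have hswap : ∫ x in Ioi (0 : ℝ), a * exp (-(a * x - b / x) ^ 2) =
      ∫ x in Ioi (0 : ℝ), b / x ^ 2 * exp (-(a * x - b / x) ^ 2) := by
    have hinj : InjOn (fun x : ℝ => b / (a * x)) (Ioi 0) := by
      intro x (hx : 0 < x) z (hz : 0 < z) h
      simp only at h
      field_simp at h
      exact h.symm
    have hd : ∀ x ∈ Ioi (0 : ℝ), HasDerivWithinAt (fun x : ℝ => b / (a * x))
        (-(b / (a * x ^ 2))) (Ioi 0) x := by
      intro x (hx : 0 < x)
      have h := ((hasDerivAt_inv hx.ne').const_mul (b / a))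
      refine ((h.congr_deriv (by field_simp)).congr_of_eventuallyEq
        (.of_forall fun z => ?_)).hasDerivWithinAt
      simp only [div_eq_mul_inv, mul_inv]
      ring
    have h := integral_image_eq_integral_abs_deriv_smul measurableSet_Ioi hd hinj
      (fun x => a * exp (-(a * x - b / x) ^ 2))
    rw [himage] at h
    rw [h]
    refine setIntegral_congr_fun measurableSet_Ioi fun x (hx : 0 < x) => ?_
    have h₁ : a * (b / (a * x)) - b / (b / (a * x)) = -(a * x - b / x) := by
      field_simp
      ring
    simp only [smul_eq_mul]
    rw [h₁, neg_sq, abs_neg, abs_of_nonneg (by positivity)]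
    field_simp
  have hsum : (∫ x in Ioi (0 : ℝ), a * exp (-(a * x - b / x) ^ 2)) +
      ∫ x in Ioi (0 : ℝ), b / x ^ 2 * exp (-(a * x - b / x) ^ 2) = √π := by
    rw [← integral_add hint₁ hint₂, ← htotal]
    refine setIntegral_congr_fun measurableSet_Ioi fun x _ => ?_
    have : 0 ≤ b / x ^ 2 := by positivity
    simp only [smul_eq_mul]
    rw [abs_of_nonneg (by positivity)]
    ring
  rw [← hswap, integral_const_mul] at hsum
  rw [eq_div_iff (by positivity)]
  linarith

theorem integral_exp_neg_mul_sq_add_div_sq {a b : ℝ} (ha : 0 < a) (hb : 0 ≤ b) :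
    ∫ x in Ioi (0 : ℝ), exp (-(a ^ 2 * x ^ 2 + b ^ 2 / x ^ 2)) =
      √π / (2 * a) * exp (-(2 * a * b)) := by
  rcases hb.eq_or_lt with rfl | hb
  · have h := integral_gaussian_Ioi (a ^ 2)
    rw [sqrt_div pi_pos.le, sqrt_sq ha.le] at h
    simp only [neg_mul] at h
    simp only [ne_eq, OfNat.ofNat_ne_zero, not_false_eq_true, zero_pow, zero_div, add_zero, h,
      mul_zero, neg_zero, exp_zero]
    field_simp
  · rw [← integral_exp_neg_mul_sub_div_sq ha hb, ← integral_mul_const]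
    refine setIntegral_congr_fun measurableSet_Ioi fun x (hx : 0 < x) => ?_
    simp only [← exp_add]
    congr 1
    field_simp
    ring

/-- The normal–exponential mixture yields the asymmetric Laplace density. -/
theorem al_mixture_representation (μ σ p y : ℝ) (hσ : 0 < σ)
    (hp : p ∈ Set.Ioo (0 : ℝ) 1) :
    (∫ w in Set.Ioi (0 : ℝ),
        (Real.sqrt (2 * Real.pi * σ ^ 2 * (2 / (p * (1 - p))) * w))⁻¹ *
          Real.exp (-(y - μ - σ * ((1 - 2 * p) / (p * (1 - p))) * w) ^ 2 /
            (2 * σ ^ 2 * (2 / (p * (1 - p))) * w)) *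
          Real.exp (-w)) =
      (p * (1 - p) / σ) *
        Real.exp (-(((y - μ) / σ) * (p - (if y < μ then 1 else 0)))) := by
  obtain ⟨hp₀, hp₁⟩ := hp
  have hp₂ : 0 < 1 - p := sub_pos.mpr hp₁
  set s := √(p * (1 - p))
  have hs : 0 < s := sqrt_pos.mpr (by positivity)
  have hsq : s ^ 2 = p * (1 - p) := sq_sqrt (by positivity)
  have hpi : 0 < √π := sqrt_pos.mpr pi_pos
  have hpisq : √π ^ 2 = π := sq_sqrt pi_pos.le
  set d := (y - μ) / σ with hd_def
  have hd : y - μ = σ * d := by rw [hd_def]; field_simp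
  rw [← integral_comp_rpow_Ioi_of_pos (p := 2) two_pos]
  have hintegrand : ∀ x ∈ Ioi (0 : ℝ),
      (2 * x ^ ((2 : ℝ) - 1)) • ((√(2 * π * σ ^ 2 * (2 / (p * (1 - p))) * x ^ (2 : ℝ)))⁻¹ *
        exp (-(y - μ - σ * ((1 - 2 * p) / (p * (1 - p))) * x ^ (2 : ℝ)) ^ 2 /
          (2 * σ ^ 2 * (2 / (p * (1 - p))) * x ^ (2 : ℝ))) * exp (-x ^ (2 : ℝ))) =
      s / (σ * √π) * exp ((1 - 2 * p) * d / 2) *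
        exp (-((1 / (2 * s)) ^ 2 * x ^ 2 + (s * |d| / 2) ^ 2 / x ^ 2)) := by
    intro x (hx : 0 < x)
    have hroot : √(2 * π * σ ^ 2 * (2 / (p * (1 - p))) * x ^ 2) = 2 * √π * σ * x / s := by
      rw [sqrt_eq_iff_mul_self_eq (by positivity) (by positivity), ← hsq]
      field_simp
      linear_combination -hpisq
    rw [show (2 : ℝ) - 1 = 1 by norm_num, rpow_one, rpow_two, smul_eq_mul, hroot,
      mul_assoc _ (exp _), mul_assoc _ (exp _), ← exp_add, ← exp_add, ← mul_assoc]
    congr 1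
    · field_simp
    · congr 1
      rw [hd, div_pow 1, mul_pow 2 s, div_pow (s * |d|), mul_pow s, sq_abs, hsq]
      field_simp
      ring
  rw [setIntegral_congr_fun measurableSet_Ioi hintegrand, integral_const_mul,
    integral_exp_neg_mul_sq_add_div_sq (by positivity) (by positivity)]
  have hexp : (1 - 2 * p) * d / 2 + -(2 * (1 / (2 * s)) * (s * |d| / 2)) =
      -(d * (p - if y < μ then 1 else 0)) := by
    split_ifs with h
    · have hneg : d < 0 := div_neg_of_neg_of_pos (sub_neg.mpr h) hσ
      rw [abs_of_neg hneg]
      clear_value d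
      field_simp
      ring
    · have hnonneg : 0 ≤ d := div_nonneg (sub_nonneg.mpr (not_lt.mp h)) hσ.le
      rw [abs_of_nonneg hnonneg]
      clear_value d
      field_simp
      ring
  rw [← hexp, exp_add, ← hsq]
  field_simp
end

section
/- For all μ ∈ ℝ, σ > 0, p ∈ (0,1), α > 0 and t > (p−1)/σ: ∫_μ^∞ exp(ty) · Φ( α(p−1) − (y−μ)/(ασ) ) · exp( −((y−μ)/σ)(p−1) + α²(p−1)²/2 ) dy = σ · [ exp(μt + α²(p−1)²/2) / ((p−1) − σt) ] · Φ(α(p−1)) − σ · [ exp(μt + α²σ²t²/2) / ((p−1) − σt) ] · Φ(ασt). -/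
open MeasureTheory Real Set

/-- The standard normal density. -/
noncomputable def stdNormalDensity (x : ℝ) : ℝ :=
  (Real.sqrt (2 * Real.pi))⁻¹ * Real.exp (-x ^ 2 / 2)

theorem stdNormalDensity_nonneg (x : ℝ) : 0 ≤ stdNormalDensity x := by
  unfold stdNormalDensity; positivity

theorem continuous_stdNormalDensity : Continuous stdNormalDensity := by
  unfold stdNormalDensity; fun_prop

theorem integrable_stdNormalDensity : Integrable stdNormalDensity := by
  have h := (integrable_exp_neg_mul_sq (b := 1 / 2) (by norm_num)).const_mul
    (Real.sqrt (2 * Real.pi))⁻¹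
  refine h.congr (Filter.Eventually.of_forall fun x => ?_)
  simp only [stdNormalDensity]
  ring_nf

theorem stdNormalDensity_add (c x : ℝ) :
    stdNormalDensity (x + c) = Real.exp (-(c ^ 2 / 2)) * (Real.exp (-(c * x)) *
      stdNormalDensity x) := by
  have h : -(x + c) ^ 2 / 2 = -(c ^ 2 / 2) + (-(c * x) + -x ^ 2 / 2) := by ring
  rw [stdNormalDensity, stdNormalDensity, h, Real.exp_add, Real.exp_add]
  ring

theorem Phi_eq_integral_stdNormalDensity (x : ℝ) :
    Phi x = ∫ s in Set.Iic x, stdNormalDensity s := rfl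

theorem Phi_nonneg (x : ℝ) : 0 ≤ Phi x :=
  integral_nonneg fun s => stdNormalDensity_nonneg s

theorem hasDerivAt_Phi_s11 (x : ℝ) : HasDerivAt Phi (stdNormalDensity x) x := by
  have h : Phi = fun z => Phi 0 + ∫ s in (0 : ℝ)..z, stdNormalDensity s := by
    funext z
    rw [← intervalIntegral.integral_Iic_sub_Iic integrable_stdNormalDensity.integrableOn
      integrable_stdNormalDensity.integrableOn, ← Phi_eq_integral_stdNormalDensity,
      ← Phi_eq_integral_stdNormalDensity]
    ring
  rw [h]
  exact (continuous_stdNormalDensity.integral_hasStrictDerivAt 0 x).hasDerivAt.const_add _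

theorem tendsto_Phi_atBot_s11 : Filter.Tendsto Phi Filter.atBot (nhds 0) :=
  tendsto_integral_Iic_zero Filter.tendsto_id

theorem integrable_exp_mul_stdNormalDensity (c : ℝ) :
    Integrable fun s => Real.exp (-(c * s)) * stdNormalDensity s := by
  refine ((integrable_stdNormalDensity.comp_add_right c).const_mul
    (Real.exp (c ^ 2 / 2))).congr (Filter.Eventually.of_forall fun s => ?_)
  simp only [stdNormalDensity_add]
  rw [← mul_assoc, ← Real.exp_add, add_neg_cancel, Real.exp_zero, one_mul]

/-- The lower tail of the standard normal law decays faster than any exponential. -/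
theorem tendsto_exp_mul_Phi_atBot {c : ℝ} (hc : 0 ≤ c) :
    Filter.Tendsto (fun z => Real.exp (-(c * z)) * Phi z) Filter.atBot (nhds 0) := by
  refine squeeze_zero (fun z => mul_nonneg (Real.exp_pos _).le (Phi_nonneg z)) (fun z => ?_)
    (tendsto_integral_Iic_zero (μ := volume)
      (f := fun s => Real.exp (-(c * s)) * stdNormalDensity s) Filter.tendsto_id)
  rw [Phi_eq_integral_stdNormalDensity, ← integral_const_mul]
  refine setIntegral_mono_on (integrable_stdNormalDensity.const_mul _).integrableOn
    (integrable_exp_mul_stdNormalDensity c).integrableOn measurableSet_Iic fun s hs => ?_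
  have hs' : s ≤ z := hs
  have := stdNormalDensity_nonneg s
  gcongr

/-- Integration by parts for an exponential against a reflected normal CDF. -/
theorem integral_Ioi_exp_mul_Phi (μ a : ℝ) {b c : ℝ} (hb : 0 < b) (hc : 0 < c) :
    ∫ y in Set.Ioi μ, Real.exp (c * b * (y - μ)) * Phi (a - b * (y - μ)) =
      (Real.exp (c * a + c ^ 2 / 2) * Phi (a + c) - Phi a) / (c * b) := by
  have hlin (d y : ℝ) : HasDerivAt (fun y => d - b * (y - μ)) (-b) y := by
    simpa using (((hasDerivAt_id y).sub_const μ).const_mul b).const_sub d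
  have hexp (y : ℝ) : HasDerivAt (fun y => Real.exp (c * b * (y - μ)))
      (Real.exp (c * b * (y - μ)) * (c * b)) y := by
    simpa using (((hasDerivAt_id y).sub_const μ).const_mul (c * b)).exp
  have hderiv (y : ℝ) : HasDerivAt
      (fun y => (Real.exp (c * b * (y - μ)) * Phi (a - b * (y - μ)) -
        Real.exp (c * a + c ^ 2 / 2) * Phi (a + c - b * (y - μ))) / (c * b))
      (Real.exp (c * b * (y - μ)) * Phi (a - b * (y - μ))) y := by
    have h := (((hexp y).mul ((hasDerivAt_Phi_s11 _).comp y (hlin a y))).sub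
      (((hasDerivAt_Phi_s11 _).comp y (hlin (a + c) y)).const_mul
        (Real.exp (c * a + c ^ 2 / 2)))).div_const (c * b)
    refine h.congr_deriv ?_
    have key : Real.exp (c * a + c ^ 2 / 2) * stdNormalDensity (a + c - b * (y - μ)) =
        Real.exp (c * b * (y - μ)) * stdNormalDensity (a - b * (y - μ)) := by
      rw [add_sub_right_comm, stdNormalDensity_add, ← mul_assoc, ← mul_assoc, ← Real.exp_add,
        ← Real.exp_add]
      ring_nf
    simp only [Function.comp_apply]
    rw [div_eq_iff (mul_pos hc hb).ne']
    linear_combination b * key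
  have hbot (d : ℝ) : Filter.Tendsto (fun y => d - b * (y - μ)) Filter.atTop Filter.atBot := by
    have h : Filter.Tendsto (fun y => b * (y - μ)) Filter.atTop Filter.atTop :=
      (Filter.tendsto_atTop_add_const_right _ (-μ) Filter.tendsto_id).const_mul_atTop hb
    exact Filter.tendsto_atBot_add_const_left _ d (Filter.tendsto_neg_atTop_atBot.comp h)
  have hlim : Filter.Tendsto
      (fun y => (Real.exp (c * b * (y - μ)) * Phi (a - b * (y - μ)) -
        Real.exp (c * a + c ^ 2 / 2) * Phi (a + c - b * (y - μ))) / (c * b))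
      Filter.atTop (nhds 0) := by
    have h := ((((tendsto_exp_mul_Phi_atBot hc.le).comp (hbot a)).const_mul
      (Real.exp (c * a))).sub ((tendsto_Phi_atBot_s11.comp (hbot (a + c))).const_mul
        (Real.exp (c * a + c ^ 2 / 2)))).div_const (c * b)
    simp only [mul_zero, sub_zero, zero_div] at h
    refine h.congr fun y => ?_
    simp only [Function.comp_apply]
    rw [← mul_assoc, ← Real.exp_add]
    ring_nf
  rw [integral_Ioi_of_hasDerivAt_of_nonneg' (fun y _ => hderiv y)
    (fun y _ => mul_nonneg (Real.exp_pos _).le (Phi_nonneg _)) hlim]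
  simp only [sub_self, mul_zero, Real.exp_zero, one_mul, sub_zero]
  ring

/-- The third component integral M₃ in the derivation of the GAL mgf (α > 0). -/
theorem gal_mgf_M3 (μ σ p α t : ℝ) (hσ : 0 < σ) (hp : p ∈ Set.Ioo (0 : ℝ) 1)
    (hα : 0 < α) (ht : (p - 1) / σ < t) :
    (∫ y in Set.Ioi μ,
        Real.exp (t * y) * Phi (α * (p - 1) - (y - μ) / (α * σ)) *
          Real.exp (-(((y - μ) / σ) * (p - 1)) + α ^ 2 * (p - 1) ^ 2 / 2)) =
      σ * (Real.exp (μ * t + α ^ 2 * (p - 1) ^ 2 / 2) / ((p - 1) - σ * t)) *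
          Phi (α * (p - 1)) -
        σ * (Real.exp (μ * t + α ^ 2 * σ ^ 2 * t ^ 2 / 2) / ((p - 1) - σ * t)) *
          Phi (α * σ * t) := by
  have hd : 0 < σ * t - (p - 1) := by
    rw [div_lt_iff₀ hσ] at ht
    linarith
  have hc : 0 < α * (σ * t - (p - 1)) := mul_pos hα hd
  have hb : 0 < (α * σ)⁻¹ := by positivity
  have hne' : σ * t - (p - 1) ≠ 0 := hd.ne'
  have hint (y : ℝ) : Real.exp (t * y) * Phi (α * (p - 1) - (y - μ) / (α * σ)) *
      Real.exp (-(((y - μ) / σ) * (p - 1)) + α ^ 2 * (p - 1) ^ 2 / 2) =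
      Real.exp (μ * t + α ^ 2 * (p - 1) ^ 2 / 2) *
        (Real.exp (α * (σ * t - (p - 1)) * (α * σ)⁻¹ * (y - μ)) *
          Phi (α * (p - 1) - (α * σ)⁻¹ * (y - μ))) := by
    rw [mul_right_comm, ← Real.exp_add, ← mul_assoc, ← Real.exp_add, div_eq_inv_mul _ (α * σ)]
    congr 2
    field_simp
    ring
  have hexp : Real.exp (μ * t + α ^ 2 * σ ^ 2 * t ^ 2 / 2) =
      Real.exp (μ * t + α ^ 2 * (p - 1) ^ 2 / 2) *
        Real.exp (α * (σ * t - (p - 1)) * (α * (p - 1)) + (α * (σ * t - (p - 1))) ^ 2 / 2) := by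
    rw [← Real.exp_add]
    ring_nf
  have harg : α * (p - 1) + α * (σ * t - (p - 1)) = α * σ * t := by ring
  simp_rw [hint]
  rw [integral_const_mul, integral_Ioi_exp_mul_Phi μ _ hb hc, harg, hexp,
    ← neg_sub (σ * t) (p - 1)]
  field_simp
  ring
end

section
/- Let μ ∈ ℝ, σ > 0, p ∈ (0,1), α > 0, let f be the GAL(μ,σ,p,α) density, and let m = μ + √(2/π)·ασ + σ(1−2p)/(p(1−p)) be its mean. Then the variance satisfies ∫_ℝ (y − m)² f(y) dy = α²σ²(1 − 2/π) + σ²(1 − 2p + 2p²)/(p²(1−p)²). -/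
open MeasureTheory Real Set

/-- The density of `α |Z|` for a standard normal variable `Z` and `α > 0`. -/
noncomputable def halfNormalPdf (α : ℝ) : ℝ → ℝ :=
  (Ioi 0).indicator fun w => 2 / (α * √(2 * π)) * exp (-w ^ 2 / (2 * α ^ 2))

/-- The density of the standard asymmetric Laplace distribution with quantile parameter `p`. -/
noncomputable def asymLaplacePdf (p u : ℝ) : ℝ :=
  p * (1 - p) * if 0 < u then exp (-(p * u)) else exp ((1 - p) * u)

/-! ### The second moment of a convolution -/

lemma integral_sq_sub_mul_convolution {h g : ℝ → ℝ}
    (hh : ∀ n : ℕ, Integrable fun w => w ^ n * h w)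
    (hg : ∀ n : ℕ, Integrable fun u => u ^ n * g u) (c : ℝ) :
    ∫ x, (x - c) ^ 2 * ∫ w, h w * g (x - w) =
      (∫ w, w ^ 2 * h w) * (∫ u, u ^ 0 * g u) + 2 * ((∫ w, w ^ 1 * h w) * ∫ u, u ^ 1 * g u) +
        (∫ w, w ^ 0 * h w) * (∫ u, u ^ 2 * g u) -
        2 * c * ((∫ w, w ^ 1 * h w) * (∫ u, u ^ 0 * g u) +
          (∫ w, w ^ 0 * h w) * ∫ u, u ^ 1 * g u) +
        c ^ 2 * ((∫ w, w ^ 0 * h w) * ∫ u, u ^ 0 * g u) := by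
  let F : ℕ → ℕ → ℝ × ℝ → ℝ := fun i j z => z.2 ^ i * h z.2 * ((z.1 - z.2) ^ j * g (z.1 - z.2))
  have hF (i j : ℕ) : Integrable (F i j) (volume.prod volume) :=
    (hh i).convolution_integrand (ContinuousLinearMap.mul ℝ ℝ) (hg j)
  have hFi (i j : ℕ) :
      ∫ z, F i j z ∂(volume.prod volume) = (∫ w, w ^ i * h w) * ∫ u, u ^ j * g u := by
    rw [integral_prod _ (hF i j)]
    exact integral_convolution (ContinuousLinearMap.mul ℝ ℝ) (hh i) (hg j)
  have h1 := (hF 2 0).add ((hF 1 1).const_mul 2)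
  have h2 := h1.add (hF 0 2)
  have h3 : Integrable (fun z => 2 * c * (F 1 0 z + F 0 1 z)) (volume.prod volume) :=
    ((hF 1 0).add (hF 0 1)).const_mul (2 * c)
  have h4 := h2.sub h3
  have h5 := (hF 0 0).const_mul (c ^ 2)
  calc ∫ x, (x - c) ^ 2 * ∫ w, h w * g (x - w)
      = ∫ x, ∫ w, (F 2 0 (x, w) + 2 * F 1 1 (x, w) + F 0 2 (x, w) -
          2 * c * (F 1 0 (x, w) + F 0 1 (x, w)) + c ^ 2 * F 0 0 (x, w)) := by
        refine integral_congr_ae (.of_forall fun x => ?_)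
        simp only [F, ← integral_const_mul]
        congr 1 with w
        ring
    _ = ∫ z, (F 2 0 z + 2 * F 1 1 z + F 0 2 z - 2 * c * (F 1 0 z + F 0 1 z) + c ^ 2 * F 0 0 z)
          ∂(volume.prod volume) := (integral_prod _ (h4.add h5)).symm
    _ = _ := by
        rw [integral_add (by exact h4) h5, integral_sub (by exact h2) h3,
          integral_add (by exact h1) (hF 0 2), integral_add (hF 2 0) ((hF 1 1).const_mul 2),
          integral_const_mul, integral_const_mul, integral_const_mul,
          integral_add (hF 1 0) (hF 0 1)]
        simp only [hFi]

/-! ### Moments of the asymmetric Laplace distribution -/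

lemma integrableOn_pow_mul_exp_neg_mul_Ioi {r : ℝ} (hr : 0 < r) (n : ℕ) :
    IntegrableOn (fun t : ℝ => t ^ n * exp (-(r * t))) (Ioi 0) := by
  refine (integrableOn_rpow_mul_exp_neg_mul_rpow (s := n) (p := 1) (b := r)
    (by linarith [n.cast_nonneg (α := ℝ)]) one_pos hr).congr_fun (fun t _ => ?_) measurableSet_Ioi
  simp

lemma integral_pow_mul_exp_neg_mul_Ioi {r : ℝ} (hr : 0 < r) (n : ℕ) :
    ∫ t in Ioi (0 : ℝ), t ^ n * exp (-(r * t)) = n.factorial / r ^ (n + 1) := by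
  have h := integral_rpow_mul_exp_neg_mul_Ioi (a := n + 1) (by positivity) hr
  rw [Gamma_nat_eq_factorial, add_sub_cancel_right] at h
  simp only [rpow_natCast] at h
  rw [h, show (n : ℝ) + 1 = ((n + 1 : ℕ) : ℝ) by push_cast; rfl, rpow_natCast, one_div_pow]
  field_simp

lemma pow_mul_asymLaplacePdf_of_pos (p : ℝ) (n : ℕ) {u : ℝ} (hu : 0 < u) :
    u ^ n * asymLaplacePdf p u = p * (1 - p) * (u ^ n * exp (-(p * u))) := by
  simp [asymLaplacePdf, hu]; ring

lemma pow_mul_asymLaplacePdf_of_nonpos (p : ℝ) (n : ℕ) {u : ℝ} (hu : u ≤ 0) :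
    u ^ n * asymLaplacePdf p u =
      p * (1 - p) * (-1) ^ n * ((-u) ^ n * exp (-((1 - p) * -u))) := by
  rw [show u ^ n = (-1) ^ n * (-u) ^ n by rw [← mul_pow]; simp]
  simp [asymLaplacePdf, hu.not_gt]; ring

lemma integrable_pow_mul_asymLaplacePdf {p : ℝ} (hp : p ∈ Ioo (0 : ℝ) 1) (n : ℕ) :
    Integrable fun u => u ^ n * asymLaplacePdf p u := by
  rw [← integrableOn_univ, ← Iic_union_Ioi (a := (0 : ℝ)), integrableOn_union]
  constructor
  · have h := integrableOn_pow_mul_exp_neg_mul_Ioi (sub_pos.2 hp.2) n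
    rw [← integrableOn_Ici_iff_integrableOn_Ioi] at h
    have h' : IntegrableOn (fun u : ℝ => (-u) ^ n * exp (-((1 - p) * -u))) (Iic 0) := by
      rw [← neg_zero] at h
      exact h.comp_neg_Iic
    exact IntegrableOn.congr_fun (h'.const_mul (p * (1 - p) * (-1) ^ n))
      (fun u hu => (pow_mul_asymLaplacePdf_of_nonpos p n hu).symm) measurableSet_Iic
  · exact IntegrableOn.congr_fun
      ((integrableOn_pow_mul_exp_neg_mul_Ioi hp.1 n).const_mul (p * (1 - p)))
      (fun u hu => (pow_mul_asymLaplacePdf_of_pos p n hu).symm) measurableSet_Ioi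

lemma integral_pow_mul_asymLaplacePdf {p : ℝ} (hp : p ∈ Ioo (0 : ℝ) 1) (n : ℕ) :
    ∫ u, u ^ n * asymLaplacePdf p u =
      p * (1 - p) * n.factorial * (1 / p ^ (n + 1) + (-1) ^ n / (1 - p) ^ (n + 1)) := by
  rw [← integral_add_compl measurableSet_Ioi (integrable_pow_mul_asymLaplacePdf hp n),
    compl_Ioi, setIntegral_congr_fun measurableSet_Ioi
      (fun u hu => pow_mul_asymLaplacePdf_of_pos p n hu),
    setIntegral_congr_fun measurableSet_Iic
      (fun u hu => pow_mul_asymLaplacePdf_of_nonpos p n hu),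
    integral_const_mul, integral_const_mul,
    integral_comp_neg_Iic 0 (fun t => t ^ n * exp (-((1 - p) * t))), neg_zero,
    integral_pow_mul_exp_neg_mul_Ioi hp.1, integral_pow_mul_exp_neg_mul_Ioi (sub_pos.2 hp.2)]
  ring

/-! ### Moments of the half-normal distribution -/

lemma pow_mul_halfNormalPdf (α : ℝ) (n : ℕ) :
    (fun w => w ^ n * halfNormalPdf α w) = (Ioi 0).indicator fun w : ℝ =>
      2 / (α * √(2 * π)) * (w ^ (n : ℝ) * exp (-(1 / (2 * α ^ 2)) * w ^ (2 : ℝ))) := by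
  ext w
  by_cases hw : w ∈ Ioi (0 : ℝ)
  · simp only [halfNormalPdf, indicator_of_mem hw, rpow_natCast, rpow_two]
    ring_nf
  · simp [halfNormalPdf, indicator_of_notMem hw]

lemma integrable_pow_mul_halfNormalPdf {α : ℝ} (hα : 0 < α) (n : ℕ) :
    Integrable fun w => w ^ n * halfNormalPdf α w := by
  rw [pow_mul_halfNormalPdf, integrable_indicator_iff measurableSet_Ioi]
  exact (integrableOn_rpow_mul_exp_neg_mul_rpow (by linarith [n.cast_nonneg (α := ℝ)])
    two_pos (by positivity)).const_mul _

lemma integral_pow_mul_halfNormalPdf {α : ℝ} (hα : 0 < α) (n : ℕ) :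
    ∫ w, w ^ n * halfNormalPdf α w =
      (√2 * α) ^ n * Gamma ((n + 1) / 2) / √π := by
  rw [pow_mul_halfNormalPdf, integral_indicator measurableSet_Ioi, integral_const_mul,
    integral_rpow_mul_exp_neg_mul_rpow two_pos (by linarith [n.cast_nonneg (α := ℝ)])
      (by positivity)]
  have h : (1 / (2 * α ^ 2)) ^ (-((n : ℝ) + 1) / 2) = (√2 * α) ^ (n + 1) := by
    rw [show 1 / (2 * α ^ 2) = (√2 * α) ^ (-2 : ℝ) by
        rw [rpow_neg (by positivity), rpow_two, mul_pow, sq_sqrt two_pos.le, one_div],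
      ← rpow_mul (by positivity), show -2 * (-((n : ℝ) + 1) / 2) = ((n + 1 : ℕ) : ℝ) by
        push_cast; ring, rpow_natCast]
  rw [h, sqrt_mul two_pos.le, pow_succ]
  field_simp

/-! ### The GAL density as a convolution -/

lemma integrable_exp_neg_sq_div_mul_exp (α q : ℝ) (hα : 0 < α) :
    Integrable fun w : ℝ => 1 / (α * √(2 * π)) * exp (-w ^ 2 / (2 * α ^ 2)) * exp (q * w) := by
  have h := ((integrable_exp_neg_mul_sq (b := 1 / (2 * α ^ 2)) (by positivity)).comp_sub_right
    (α ^ 2 * q)).const_mul (1 / (α * √(2 * π)) * exp ((α * q) ^ 2 / 2))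
  refine h.congr (.of_forall fun w => ?_)
  simp only [mul_assoc, ← exp_add]
  congr 2
  field_simp
  ring

lemma integral_Iic_exp_neg_sq_div_mul_exp (α q b : ℝ) (hα : 0 < α) :
    ∫ w in Iic b, 1 / (α * √(2 * π)) * exp (-w ^ 2 / (2 * α ^ 2)) * exp (q * w) =
      exp ((α * q) ^ 2 / 2) * Phi (b / α - α * q) := by
  rw [Phi, ← integral_const_mul, ← integral_indicator measurableSet_Iic,
    ← integral_indicator measurableSet_Iic]
  set G : ℝ → ℝ := (Iic b).indicator
    fun w => 1 / (α * √(2 * π)) * exp (-w ^ 2 / (2 * α ^ 2)) * exp (q * w)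
  have h1 := Measure.integral_comp_mul_left (fun w => G w) α
  have h2 := integral_add_right_eq_self (μ := volume) (fun t => G (α * t)) (α * q)
  rw [h1, abs_of_pos (by positivity), smul_eq_mul] at h2
  rw [show ∫ w, G w = α * (α⁻¹ * ∫ w, G w) by field_simp, ← h2, ← integral_const_mul]
  congr 1 with t
  have hiff : α * (t + α * q) ∈ Iic b ↔ t ∈ Iic (b / α - α * q) := by
    rw [mem_Iic, mem_Iic, le_sub_iff_add_le, le_div_iff₀ hα, mul_comm]
  by_cases ht : t ∈ Iic (b / α - α * q)
  · rw [indicator_of_mem ht]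
    simp only [G]
    rw [indicator_of_mem (hiff.2 ht), mul_assoc, ← exp_add, mul_left_comm (exp _), ← exp_add,
      ← mul_assoc]
    congr 1
    · field_simp
    · congr 1
      field_simp
      ring
  · rw [indicator_of_notMem ht]
    simp only [G]
    rw [indicator_of_notMem (mt hiff.1 ht), mul_zero]

lemma integral_Ioi_exp_neg_sq_div_mul_exp (α q a : ℝ) (hα : 0 < α) :
    ∫ w in Ioi a, 1 / (α * √(2 * π)) * exp (-w ^ 2 / (2 * α ^ 2)) * exp (q * w) =
      exp ((α * q) ^ 2 / 2) * Phi (α * q - a / α) := by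
  have h := integral_Iic_exp_neg_sq_div_mul_exp α (-q) (-a) hα
  rw [← integral_comp_neg_Ioi] at h
  simp only [neg_sq, neg_mul, mul_neg, neg_neg, neg_div, sub_neg_eq_add] at h ⊢
  rw [h]
  ring_nf

lemma integral_Ioc_exp_neg_sq_div_mul_exp (α q : ℝ) {a b : ℝ} (hα : 0 < α) (hab : a ≤ b) :
    ∫ w in Ioc a b, 1 / (α * √(2 * π)) * exp (-w ^ 2 / (2 * α ^ 2)) * exp (q * w) =
      exp ((α * q) ^ 2 / 2) * (Phi (b / α - α * q) - Phi (a / α - α * q)) := by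
  have hi := integrable_exp_neg_sq_div_mul_exp α q hα
  rw [← intervalIntegral.integral_of_le hab,
    ← intervalIntegral.integral_Iic_sub_Iic hi.integrableOn hi.integrableOn,
    integral_Iic_exp_neg_sq_div_mul_exp α q b hα, integral_Iic_exp_neg_sq_div_mul_exp α q a hα,
    mul_sub]

lemma integral_Ioi_halfNormal_mul_asymLaplacePdf (α p : ℝ) {a x : ℝ} (hα : 0 < α) (hxa : x ≤ a) :
    ∫ w in Ioi a, 2 / (α * √(2 * π)) * exp (-w ^ 2 / (2 * α ^ 2)) * asymLaplacePdf p (x - w) =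
      2 * p * (1 - p) * (exp (-(x * (p - 1)) + (α * (p - 1)) ^ 2 / 2) *
        Phi (α * (p - 1) - a / α)) := by
  rw [exp_add, mul_assoc (exp _), ← integral_Ioi_exp_neg_sq_div_mul_exp α (p - 1) a hα,
    ← integral_const_mul, ← integral_const_mul]
  refine setIntegral_congr_fun measurableSet_Ioi fun w hw => ?_
  have hw' : ¬ 0 < x - w := by linarith [mem_Ioi.1 hw]
  simp only [asymLaplacePdf, hw', if_false]
  rw [show (1 - p) * (x - w) = -(x * (p - 1)) + (p - 1) * w by ring, exp_add]
  ring

lemma integral_Ioc_halfNormal_mul_asymLaplacePdf (α p : ℝ) {x : ℝ} (hα : 0 < α) (hx : 0 ≤ x) :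
    ∫ w in Ioc 0 x, 2 / (α * √(2 * π)) * exp (-w ^ 2 / (2 * α ^ 2)) * asymLaplacePdf p (x - w) =
      2 * p * (1 - p) * (exp (-(x * p) + (α * p) ^ 2 / 2) *
        (Phi (x / α - α * p) - Phi (-(α * p)))) := by
  have h := integral_Ioc_exp_neg_sq_div_mul_exp α p hα hx
  rw [zero_div, zero_sub] at h
  rw [exp_add, mul_assoc (exp _), ← h, ← integral_const_mul, ← integral_const_mul,
    integral_Ioc_eq_integral_Ioo, integral_Ioc_eq_integral_Ioo]
  refine setIntegral_congr_fun measurableSet_Ioo fun w hw => ?_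
  simp only [asymLaplacePdf, sub_pos.2 hw.2, if_true]
  rw [show -(p * (x - w)) = -(x * p) + p * w by ring, exp_add]
  ring

lemma integrable_halfNormal_mul_asymLaplacePdf {α p : ℝ} (hα : 0 < α) (x : ℝ)
    (hp : p ∈ Ioo (0 : ℝ) 1) :
    Integrable fun w : ℝ =>
      2 / (α * √(2 * π)) * exp (-w ^ 2 / (2 * α ^ 2)) * asymLaplacePdf p (x - w) := by
  have hg : Integrable (asymLaplacePdf p) := by
    simpa using integrable_pow_mul_asymLaplacePdf hp 0
  refine (hg.comp_sub_left x).bdd_mul (c := 2 / (α * √(2 * π))) (by fun_prop)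
    (.of_forall fun w => ?_)
  rw [norm_of_nonneg (by positivity)]
  refine mul_le_of_le_one_right (by positivity) (exp_le_one_iff.2 ?_)
  rw [neg_div]
  exact neg_nonpos.2 (by positivity)

lemma galPdf_eq_integral {μ σ p α : ℝ} (hp : p ∈ Ioo (0 : ℝ) 1) (hα : 0 < α) (y : ℝ) :
    galPdf μ σ p α y =
      σ⁻¹ * ∫ w, halfNormalPdf α w * asymLaplacePdf p ((y - μ) / σ - w) := by
  simp only [galPdf, hα, hα.not_gt, if_true, if_false, sub_zero]
  set x := (y - μ) / σ
  have hind : (fun w => halfNormalPdf α w * asymLaplacePdf p (x - w)) = (Ioi 0).indicator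
      fun w => 2 / (α * √(2 * π)) * exp (-w ^ 2 / (2 * α ^ 2)) * asymLaplacePdf p (x - w) :=
    funext fun w => (indicator_mul_left (Ioi 0) _ fun w => asymLaplacePdf p (x - w)).symm
  rw [hind, integral_indicator measurableSet_Ioi]
  by_cases hx : 0 < x
  · have hi := integrable_halfNormal_mul_asymLaplacePdf hα x hp
    rw [← Ioc_union_Ioi_eq_Ioi hx.le, setIntegral_union (Ioc_disjoint_Ioi le_rfl)
      measurableSet_Ioi hi.integrableOn hi.integrableOn,
      integral_Ioc_halfNormal_mul_asymLaplacePdf α p hα hx.le,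
      integral_Ioi_halfNormal_mul_asymLaplacePdf α p hα le_rfl, if_pos (div_pos hx hα)]
    ring_nf
  · rw [integral_Ioi_halfNormal_mul_asymLaplacePdf α p hα (not_lt.1 hx),
      if_neg (by rw [div_pos_iff_of_pos_right hα]; exact hx)]
    ring_nf

/-- The variance of the GAL distribution. -/
theorem gal_variance (μ σ p α : ℝ) (hσ : 0 < σ) (hp : p ∈ Set.Ioo (0 : ℝ) 1)
    (hα : 0 < α) :
    (∫ y : ℝ,
        (y - (μ + Real.sqrt (2 / Real.pi) * α * σ + σ * (1 - 2 * p) / (p * (1 - p)))) ^ 2 *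
          galPdf μ σ p α y) =
      α ^ 2 * σ ^ 2 * (1 - 2 / Real.pi) +
        σ ^ 2 * (1 - 2 * p + 2 * p ^ 2) / (p ^ 2 * (1 - p) ^ 2) := by
  obtain ⟨hp0, hp1⟩ := id hp
  have hp1' : 0 < 1 - p := sub_pos.2 hp1
  set c := √(2 / π) * α + (1 - 2 * p) / (p * (1 - p)) with hc
  let F : ℝ → ℝ := fun x =>
    σ * ((x - c) ^ 2 * ∫ w, halfNormalPdf α w * asymLaplacePdf p (x - w))
  have hF (y : ℝ) :
      (y - (μ + √(2 / π) * α * σ + σ * (1 - 2 * p) / (p * (1 - p)))) ^ 2 * galPdf μ σ p α y =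
        F (σ⁻¹ * (y - μ)) := by
    rw [galPdf_eq_integral hp hα, div_eq_inv_mul (y - μ),
      show y - (μ + √(2 / π) * α * σ + σ * (1 - 2 * p) / (p * (1 - p))) =
        σ * (σ⁻¹ * (y - μ) - c) by rw [hc]; field_simp; ring]
    simp only [F]
    field_simp
  simp_rw [hF]
  rw [integral_sub_right_eq_self (fun y => F (σ⁻¹ * y)) μ, Measure.integral_comp_mul_left,
    inv_inv, abs_of_pos hσ, smul_eq_mul, integral_const_mul,
    integral_sq_sub_mul_convolution (integrable_pow_mul_halfNormalPdf hα)
      (integrable_pow_mul_asymLaplacePdf hp)]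
  simp only [integral_pow_mul_halfNormalPdf hα, integral_pow_mul_asymLaplacePdf hp]
  have hG : Gamma ((2 + 1) / 2) = √π / 2 := by
    rw [show ((2 : ℝ) + 1) / 2 = 1 / 2 + 1 by norm_num, Gamma_add_one (by norm_num),
      Gamma_one_half_eq]
    ring
  have hs2 : √2 ^ 2 = 2 := sq_sqrt two_pos.le
  have hsπ : √π ^ 2 = π := sq_sqrt pi_pos.le
  have hπ : √π ≠ 0 := by positivity
  simp only [Nat.cast_zero, Nat.cast_one, Nat.cast_ofNat, zero_add, one_add_one_eq_two, hG,
    div_self (two_ne_zero (α := ℝ)), Gamma_one, Gamma_one_half_eq, Nat.factorial]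
  rw [hc, sqrt_div two_pos.le, ← hsπ, sqrt_sq (sqrt_nonneg π)]
  push_cast
  field_simp
  ring_nf
  simp only [hs2]
  ring
end

section
/- Let μ ∈ ℝ, σ > 0, p ∈ (0,1), α > 0, let f be the GAL(μ,σ,p,α) density, and let m = μ + √(2/π)·ασ + σ(1−2p)/(p(1−p)) be its mean. Then the skewness satisfies ( ∫_ℝ (y − m)³ f(y) dy ) / ( ∫_ℝ (y − m)² f(y) dy )^{3/2} = [ α³·√(2/π)·(4/π − 1) + 2·((1−p)³ − p³)/(p³(1−p)³) ] / [ α²·(1 − 2/π) + (1 − 2p + 2p²)/(p²(1−p)²) ]^{3/2}; in particular the skewness does not depend on μ or σ. -/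
open MeasureTheory Real Set

lemma integrable_sub_pow_mul {k : ℝ → ℝ} {n : ℕ} (c : ℝ)
    (hk : ∀ j ≤ n, Integrable fun s ↦ s ^ j * k s) :
    Integrable fun s ↦ (s - c) ^ n * k s := by
  simp_rw [sub_eq_add_neg, add_pow, Finset.sum_mul]
  refine integrable_finsetSum _ fun j hj ↦ ?_
  exact ((hk j (Finset.mem_range_succ_iff.1 hj)).mul_const ((-c) ^ (n - j) * n.choose j)).congr
    (.of_forall fun s ↦ by ring)

lemma integral_sub_pow_mul {k : ℝ → ℝ} {n : ℕ} (c : ℝ)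
    (hk : ∀ j ≤ n, Integrable fun s ↦ s ^ j * k s) :
    ∫ s, (s - c) ^ n * k s =
      ∑ j ∈ Finset.range (n + 1), (∫ s, s ^ j * k s) * ((-c) ^ (n - j) * n.choose j) := by
  have h : ∀ s, (s - c) ^ n * k s =
      ∑ j ∈ Finset.range (n + 1), (s ^ j * k s) * ((-c) ^ (n - j) * n.choose j) := fun s ↦ by
    rw [sub_eq_add_neg, add_pow, Finset.sum_mul]
    exact Finset.sum_congr rfl fun j _ ↦ by ring
  simp_rw [h]
  rw [integral_finsetSum _ fun j hj ↦ (hk j (Finset.mem_range_succ_iff.1 hj)).mul_const _]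
  simp_rw [integral_mul_const]

/-- Moments of a convolution in terms of the moments of the two factors. -/
lemma integral_sub_pow_mul_convolution {k a : ℝ → ℝ} {n : ℕ} (c d : ℝ)
    (hk : ∀ j ≤ n, Integrable fun s ↦ s ^ j * k s)
    (ha : ∀ j ≤ n, Integrable fun e ↦ e ^ j * a e) :
    ∫ u, (u - (c + d)) ^ n * ∫ s, k s * a (u - s) =
      ∑ j ∈ Finset.range (n + 1),
        (∫ s, (s - c) ^ j * k s) * (∫ e, (e - d) ^ (n - j) * a e) * n.choose j := by
  have hK : ∀ j ≤ n, Integrable fun s ↦ (s - c) ^ j * k s := fun j hj ↦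
    integrable_sub_pow_mul c fun i hi ↦ hk i (hi.trans hj)
  have hA : ∀ j ≤ n, Integrable fun e ↦ (e - d) ^ j * a e := fun j hj ↦
    integrable_sub_pow_mul d fun i hi ↦ ha i (hi.trans hj)
  have h : ∀ u s, (u - (c + d)) ^ n * (k s * a (u - s)) =
      ∑ j ∈ Finset.range (n + 1), ((s - c) ^ j * k s) *
        (((u - s) - d) ^ (n - j) * a (u - s)) * n.choose j := fun u s ↦ by
    rw [show u - (c + d) = (s - c) + ((u - s) - d) by ring, add_pow, Finset.sum_mul]
    exact Finset.sum_congr rfl fun j _ ↦ by ring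
  have h'' : ∀ u, (u - (c + d)) ^ n * ∫ s, k s * a (u - s) =
      ∫ s, ∑ j ∈ Finset.range (n + 1), ((s - c) ^ j * k s) *
        (((u - s) - d) ^ (n - j) * a (u - s)) * n.choose j := fun u ↦ by
    rw [← integral_const_mul]
    simp_rw [h]
  simp_rw [h'']
  rw [integral_integral_swap]
  · have h' : ∀ s, ∫ u, ∑ j ∈ Finset.range (n + 1), ((s - c) ^ j * k s) *
        (((u - s) - d) ^ (n - j) * a (u - s)) * n.choose j =
        ∑ j ∈ Finset.range (n + 1), ((s - c) ^ j * k s) *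
          (∫ e, (e - d) ^ (n - j) * a e) * n.choose j := fun s ↦ by
      rw [integral_finsetSum]
      · refine Finset.sum_congr rfl fun j _ ↦ ?_
        rw [integral_mul_const, integral_const_mul,
          integral_sub_right_eq_self (fun e ↦ (e - d) ^ (n - j) * a e) s]
      · exact fun j _ ↦ (((hA (n - j) (Nat.sub_le _ _)).comp_sub_right s).const_mul _).mul_const _
    simp_rw [h']
    rw [integral_finsetSum]
    · exact Finset.sum_congr rfl fun j _ ↦ by rw [integral_mul_const, integral_mul_const]
    · exact fun j hj ↦ ((hK j (Finset.mem_range_succ_iff.1 hj)).mul_const _).mul_const _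
  · refine integrable_finsetSum (μ := volume.prod volume) (Finset.range (n + 1))
      (f := fun j (q : ℝ × ℝ) ↦ ((q.2 - c) ^ j * k q.2) *
        (((q.1 - q.2) - d) ^ (n - j) * a (q.1 - q.2)) * n.choose j) fun j hj ↦ ?_
    exact ((hK j (Finset.mem_range_succ_iff.1 hj)).convolution_integrand
      (ContinuousLinearMap.mul ℝ ℝ) (hA (n - j) (Nat.sub_le _ _))).mul_const _

/-- Density of `α * |Z|` for a standard normal variable `Z`. -/
noncomputable def halfNormalDensity (α : ℝ) : ℝ → ℝ :=
  (Ioi 0).indicator fun s ↦ 2 / α * ((√(2 * π))⁻¹ * exp (-(s / α) ^ 2 / 2))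

/-- Density of the asymmetric Laplace distribution with unit scale. -/
noncomputable def asymLaplaceDensity (p : ℝ) : ℝ → ℝ := fun e ↦
  (Ioi 0).indicator (fun e ↦ p * (1 - p) * exp (-(p * e))) e +
    (Iic 0).indicator (fun e ↦ p * (1 - p) * exp ((1 - p) * e)) e

lemma pow_mul_halfNormalDensity (α : ℝ) (j : ℕ) :
    (fun s ↦ s ^ j * halfNormalDensity α s) = (Ioi 0).indicator fun s ↦
      (2 / α * (√(2 * π))⁻¹) * (s ^ (j : ℝ) * exp (-(1 / (2 * α ^ 2)) * s ^ (2 : ℝ))) := by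
  ext s
  rw [halfNormalDensity, ← indicator_mul_right _ fun s : ℝ ↦ s ^ j]
  congr 1
  ext s
  rw [rpow_natCast, rpow_two, show -(1 / (2 * α ^ 2)) * s ^ 2 = -(s / α) ^ 2 / 2 by
    rw [div_pow]; ring]
  ring

lemma integrable_pow_mul_halfNormalDensity {α : ℝ} (hα : 0 < α) (j : ℕ) :
    Integrable fun s ↦ s ^ j * halfNormalDensity α s := by
  rw [pow_mul_halfNormalDensity, integrable_indicator_iff measurableSet_Ioi]
  exact (integrableOn_rpow_mul_exp_neg_mul_rpow (by have := j.cast_nonneg (α := ℝ); linarith)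
    two_pos (by positivity)).const_mul _

lemma integral_pow_mul_halfNormalDensity {α : ℝ} (hα : 0 < α) (j : ℕ) :
    ∫ s, s ^ j * halfNormalDensity α s = α ^ j * √2 ^ j / √π * Gamma ((j + 1) / 2) := by
  rw [pow_mul_halfNormalDensity, integral_indicator measurableSet_Ioi, integral_const_mul,
    integral_rpow_mul_exp_neg_mul_rpow two_pos (by have := j.cast_nonneg (α := ℝ); linarith)
      (by positivity)]
  have h : (1 / (2 * α ^ 2)) ^ (-((j : ℝ) + 1) / 2) = (√2 * α) ^ (j + 1) := by
    have h2 : 1 / (2 * α ^ 2) = (√2 * α) ^ (-2 : ℝ) := by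
      rw [rpow_neg (by positivity), rpow_two, mul_pow, sq_sqrt zero_le_two, one_div]
    rw [h2, ← rpow_mul (by positivity), ← rpow_natCast]
    congr 1
    push_cast
    ring
  rw [h, sqrt_mul zero_le_two]
  field_simp
  ring

lemma pow_mul_asymLaplaceDensity (p : ℝ) (j : ℕ) :
    (fun e ↦ e ^ j * asymLaplaceDensity p e) =
      (Ioi 0).indicator (fun e ↦ p * (1 - p) * (e ^ j * exp (-(p * e)))) +
        (Iic 0).indicator (fun e ↦ p * (1 - p) * (e ^ j * exp ((1 - p) * e))) := by
  ext e
  rw [asymLaplaceDensity, mul_add, ← indicator_mul_right _ fun s : ℝ ↦ s ^ j,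
    ← indicator_mul_right _ fun s : ℝ ↦ s ^ j, Pi.add_apply]
  congr 3 <;> ext e <;> ring

lemma integrableOn_pow_mul_exp_neg {r : ℝ} (hr : 0 < r) (j : ℕ) :
    IntegrableOn (fun e ↦ e ^ j * exp (-(r * e))) (Ioi 0) := by
  have := integrableOn_rpow_mul_exp_neg_mul_rpow (s := j) (p := 1)
    (by have := j.cast_nonneg (α := ℝ); linarith) one_pos hr
  simpa only [rpow_natCast, rpow_one, neg_mul] using this

lemma integral_pow_mul_exp_neg {r : ℝ} (hr : 0 < r) (j : ℕ) :
    ∫ e in Ioi 0, e ^ j * exp (-(r * e)) = j.factorial / r ^ (j + 1) := by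
  have := integral_rpow_mul_exp_neg_mul_Ioi (a := j + 1) (by positivity) hr
  rw [Gamma_nat_eq_factorial, add_sub_cancel_right] at this
  simp only [rpow_natCast] at this
  rw [this, ← Nat.cast_add_one, rpow_natCast, one_div, inv_pow, mul_comm, div_eq_mul_inv]

lemma integrableOn_pow_mul_exp_Iic {r : ℝ} (hr : 0 < r) (j : ℕ) :
    IntegrableOn (fun e ↦ e ^ j * exp (r * e)) (Iic 0) := by
  have h := (integrableOn_pow_mul_exp_neg hr j).const_mul ((-1) ^ j)
  rw [← IntegrableOn, ← integrableOn_Ici_iff_integrableOn_Ioi, ← neg_zero] at h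
  convert h.comp_neg_Iic using 2 with e
  rw [neg_pow e, ← mul_assoc, ← mul_assoc, ← mul_pow]
  simp

lemma integral_pow_mul_exp_Iic {r : ℝ} (hr : 0 < r) (j : ℕ) :
    ∫ e in Iic 0, e ^ j * exp (r * e) = (-1) ^ j * (j.factorial / r ^ (j + 1)) := by
  rw [← integral_pow_mul_exp_neg hr, ← integral_const_mul]
  have h := integral_comp_neg_Ioi 0 fun e ↦ e ^ j * exp (r * e)
  rw [neg_zero] at h
  rw [← h]
  congr 1 with e
  rw [neg_pow e, mul_neg, mul_assoc]

lemma integrable_pow_mul_asymLaplaceDensity {p : ℝ} (hp : p ∈ Ioo (0 : ℝ) 1) (j : ℕ) :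
    Integrable fun e ↦ e ^ j * asymLaplaceDensity p e := by
  rw [pow_mul_asymLaplaceDensity]
  exact ((integrable_indicator_iff measurableSet_Ioi).2
    ((integrableOn_pow_mul_exp_neg hp.1 j).const_mul _)).add
    ((integrable_indicator_iff measurableSet_Iic).2
      ((integrableOn_pow_mul_exp_Iic (sub_pos.2 hp.2) j).const_mul _))

lemma integral_pow_mul_asymLaplaceDensity {p : ℝ} (hp : p ∈ Ioo (0 : ℝ) 1) (j : ℕ) :
    ∫ e, e ^ j * asymLaplaceDensity p e =
      p * (1 - p) * (j.factorial / p ^ (j + 1) + (-1) ^ j * (j.factorial / (1 - p) ^ (j + 1))) := by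
  rw [pow_mul_asymLaplaceDensity, integral_add'
    ((integrable_indicator_iff measurableSet_Ioi).2
      ((integrableOn_pow_mul_exp_neg hp.1 j).const_mul _))
    ((integrable_indicator_iff measurableSet_Iic).2
      ((integrableOn_pow_mul_exp_Iic (sub_pos.2 hp.2) j).const_mul _)),
    integral_indicator measurableSet_Ioi, integral_indicator measurableSet_Iic,
    integral_const_mul, integral_const_mul, integral_pow_mul_exp_neg hp.1,
    integral_pow_mul_exp_Iic (sub_pos.2 hp.2), mul_add]

/-- Partial moment generating function of a centred normal variable. -/
lemma integral_Iic_gaussian_mul_exp {α : ℝ} (hα : 0 < α) (q v : ℝ) :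
    ∫ s in Iic v, (√(2 * π))⁻¹ * exp (-(s / α) ^ 2 / 2) * exp (q * s) =
      α * (exp ((α * q) ^ 2 / 2) * Phi (v / α - α * q)) := by
  set φ : ℝ → ℝ := (Iic (v / α - α * q)).indicator fun t ↦ (√(2 * π))⁻¹ * exp (-t ^ 2 / 2) with hφ_def
  have hφ : ∫ s, φ (s / α - α * q) = α * Phi (v / α - α * q) := by
    rw [Measure.integral_comp_div (fun t ↦ φ (t - α * q)), integral_sub_right_eq_self,
      integral_indicator measurableSet_Iic, abs_of_pos hα, Phi, smul_eq_mul]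
  rw [mul_left_comm, ← hφ, ← integral_const_mul, ← integral_indicator measurableSet_Iic]
  congr 1 with s
  by_cases hs : s ≤ v
  · have hs' : s / α - α * q ≤ v / α - α * q := by gcongr
    rw [indicator_of_mem (mem_Iic.2 hs), hφ_def, indicator_of_mem (mem_Iic.2 hs'), mul_assoc,
      mul_left_comm (exp ((α * q) ^ 2 / 2)), ← exp_add, ← exp_add]
    congr 2
    field_simp
    ring
  · have hs' : ¬ s / α - α * q ≤ v / α - α * q := by
      rw [sub_le_sub_iff_right, div_le_div_iff_of_pos_right hα]; exact hs
    rw [indicator_of_notMem (mt mem_Iic.1 hs), hφ_def, indicator_of_notMem (mt mem_Iic.1 hs'), mul_zero]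

lemma integral_Ioi_gaussian_mul_exp {α : ℝ} (hα : 0 < α) (q v : ℝ) :
    ∫ s in Ioi v, (√(2 * π))⁻¹ * exp (-(s / α) ^ 2 / 2) * exp (-(q * s)) =
      α * (exp ((α * q) ^ 2 / 2) * Phi (-(v / α) - α * q)) := by
  rw [← neg_div, ← integral_Iic_gaussian_mul_exp hα, ← integral_comp_neg_Ioi]
  simp [neg_div]

lemma integrable_gaussian_mul_exp {α : ℝ} (hα : 0 < α) (q : ℝ) :
    Integrable fun s ↦ (√(2 * π))⁻¹ * exp (-(s / α) ^ 2 / 2) * exp (q * s) := by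
  have h := (((integrable_exp_neg_mul_sq (b := 1 / 2) (by norm_num)).comp_sub_right
    (α * q)).comp_div hα.ne').const_mul ((√(2 * π))⁻¹ * exp ((α * q) ^ 2 / 2))
  convert h using 2 with s
  rw [mul_assoc, mul_assoc, ← exp_add, ← exp_add]
  congr 2
  field_simp
  ring

lemma galPdf_eq_convolution (μ : ℝ) {σ p α : ℝ} (hα : 0 < α) (y : ℝ) :
    galPdf μ σ p α y =
      σ⁻¹ * ∫ s, halfNormalDensity α s * asymLaplaceDensity p ((y - μ) / σ - s) := by
  set u := (y - μ) / σ with hu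
  set g : ℝ → ℝ → ℝ := fun q s ↦ (√(2 * π))⁻¹ * exp (-(s / α) ^ 2 / 2) * exp (q * s) with hg
  set v := max u 0 with hv
  have hv0 : 0 ≤ v := le_max_right _ _
  have hsplit : ∀ s, halfNormalDensity α s * asymLaplaceDensity p (u - s) =
      (Ioc 0 v).indicator
          (fun s ↦ 2 / α * p * (1 - p) * exp (-(p * u)) * g p s) s +
        (Ioi v).indicator
          (fun s ↦ 2 / α * p * (1 - p) * exp ((1 - p) * u) * g (-(1 - p)) s) s := by
    intro s
    rcases le_or_gt s 0 with hs | hs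
    · have h1 : s ∉ Ioi (0 : ℝ) := not_lt.2 hs
      have h2 : s ∉ Ioc 0 v := fun h ↦ h1 h.1
      have h3 : s ∉ Ioi v := not_lt.2 (hs.trans hv0)
      simp only [halfNormalDensity, indicator_of_notMem, h1, h2, h3, not_false_eq_true, zero_mul,
        add_zero]
    rcases le_or_gt s u with hsu | hsu
    · have h3 : s ∉ Ioi v := not_lt.2 (hsu.trans (le_max_left _ _))
      have h2 : s ∈ Ioc 0 v := ⟨hs, hsu.trans (le_max_left _ _)⟩
      rw [halfNormalDensity, indicator_of_mem (mem_Ioi.2 hs), indicator_of_notMem h3,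
        indicator_of_mem h2, add_zero]
      have h4 : asymLaplaceDensity p (u - s) = p * (1 - p) * (exp (-(p * u)) * exp (p * s)) := by
        rw [← exp_add]
        rcases hsu.eq_or_lt with rfl | hlt
        · simp [asymLaplaceDensity]
        · have h5 : u - s ∉ Iic (0 : ℝ) := not_le.2 (sub_pos.2 hlt)
          rw [asymLaplaceDensity, indicator_of_mem (mem_Ioi.2 (sub_pos.2 hlt)),
            indicator_of_notMem h5, add_zero]
          ring_nf
      rw [h4, hg]
      ring
    · have h3 : s ∈ Ioi v := max_lt hsu hs
      have h2 : s ∉ Ioc 0 v := fun h ↦ not_lt.2 h.2 h3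
      have h5 : u - s ∉ Ioi (0 : ℝ) := not_lt.2 (sub_nonpos.2 hsu.le)
      rw [halfNormalDensity, indicator_of_mem (mem_Ioi.2 hs), indicator_of_mem h3,
        indicator_of_notMem h2, zero_add, asymLaplaceDensity, indicator_of_notMem h5,
        indicator_of_mem (mem_Iic.2 (sub_nonpos.2 hsu.le)), zero_add,
        show (1 - p) * (u - s) = (1 - p) * u + -(1 - p) * s by ring, exp_add, hg]
      ring
  have hint : ∀ q, Integrable (g q) := integrable_gaussian_mul_exp hα
  have hIoc : ∫ s in Ioc 0 v, g p s = α * (exp ((α * p) ^ 2 / 2) *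
      (Phi (v / α - α * p) - Phi (-(α * p)))) := by
    have h := intervalIntegral.integral_Iic_sub_Iic (hint p).integrableOn
      (hint p).integrableOn (a := 0) (b := v)
    rw [intervalIntegral.integral_of_le hv0, integral_Iic_gaussian_mul_exp hα,
      integral_Iic_gaussian_mul_exp hα, zero_div, zero_sub] at h
    rw [← h]
    ring
  have hIoi : ∫ s in Ioi v, g (-(1 - p)) s = α * (exp ((α * (p - 1)) ^ 2 / 2) *
      Phi (α * (p - 1) - v / α)) := by
    have h := integral_Ioi_gaussian_mul_exp hα (1 - p) v
    simp only [hg, neg_mul]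
    rw [h]
    ring_nf
  simp_rw [hsplit]
  rw [integral_add (((hint p).const_mul _).indicator measurableSet_Ioc)
    (((hint _).const_mul _).indicator measurableSet_Ioi), integral_indicator measurableSet_Ioc,
    integral_indicator measurableSet_Ioi, integral_const_mul, integral_const_mul, hIoc, hIoi]
  simp only [galPdf, ← hu, hα, hα.not_gt, if_true, if_false, sub_zero, exp_add, div_pos_iff_of_pos_right]
  rcases le_or_gt u 0 with h | h
  · rw [hv, max_eq_right h, if_neg h.not_gt]
    rw [show (1 - p) * u = -(u * (p - 1)) by ring]
    simp
    field_simp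
  · rw [hv, max_eq_left h.le, if_pos h]
    rw [show (1 - p) * u = -(u * (p - 1)) by ring, mul_comm p u]
    field_simp

/-- Central moments of the GAL distribution in terms of those of its two components. -/
lemma integral_sub_pow_mul_galPdf (μ : ℝ) {σ p α : ℝ} (hσ : 0 < σ) (hp : p ∈ Ioo (0 : ℝ) 1)
    (hα : 0 < α) (c d : ℝ) (n : ℕ) :
    ∫ y, (y - (μ + c * σ + σ * d)) ^ n * galPdf μ σ p α y =
      σ ^ n * ∑ j ∈ Finset.range (n + 1), (∫ s, (s - c) ^ j * halfNormalDensity α s) *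
        (∫ e, (e - d) ^ (n - j) * asymLaplaceDensity p e) * n.choose j := by
  rw [← integral_sub_pow_mul_convolution c d
    (fun j _ ↦ integrable_pow_mul_halfNormalDensity hα j)
    (fun j _ ↦ integrable_pow_mul_asymLaplaceDensity hp j), ← integral_const_mul]
  set F : ℝ → ℝ := fun u ↦ σ ^ n * ((u - (c + d)) ^ n *
    ∫ s, halfNormalDensity α s * asymLaplaceDensity p (u - s))
  have h : ∀ y, (y - (μ + c * σ + σ * d)) ^ n * galPdf μ σ p α y = σ⁻¹ * F ((y - μ) / σ) := by
    intro y
    rw [galPdf_eq_convolution μ hα, show y - (μ + c * σ + σ * d) =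
      σ * ((y - μ) / σ - (c + d)) by field_simp; ring, mul_pow]
    simp only [F]
    ring
  simp_rw [h]
  rw [integral_const_mul, integral_sub_right_eq_self (fun y ↦ F (y / σ)),
    Measure.integral_comp_div, abs_of_pos hσ, smul_eq_mul, inv_mul_cancel_left₀ hσ.ne']

lemma integral_sub_pow_mul_halfNormalDensity {α : ℝ} (hα : 0 < α) :
    (∫ s, (s - √(2 / π) * α) ^ 0 * halfNormalDensity α s = 1) ∧
    (∫ s, (s - √(2 / π) * α) ^ 1 * halfNormalDensity α s = 0) ∧
    (∫ s, (s - √(2 / π) * α) ^ 2 * halfNormalDensity α s = α ^ 2 * (1 - 2 / π)) ∧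
    (∫ s, (s - √(2 / π) * α) ^ 3 * halfNormalDensity α s =
      α ^ 3 * √(2 / π) * (4 / π - 1)) := by
  have h := integral_pow_mul_halfNormalDensity hα
  have hG3 : Gamma ((2 + 1) / 2) = √π / 2 := by
    rw [show ((2 : ℝ) + 1) / 2 = 1 / 2 + 1 by norm_num, Gamma_add_one (by norm_num),
      Gamma_one_half_eq]
    ring
  have h2 : √(2 : ℝ) ^ 2 = 2 := sq_sqrt zero_le_two
  have h2' : √(2 : ℝ) ^ 3 = 2 * √2 := by rw [pow_succ, h2]
  have hπ0 : 0 < √π := sqrt_pos.2 pi_pos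
  have hπ : √π ^ 2 = π := sq_sqrt pi_pos.le
  have m0 : ∫ s, s ^ 0 * halfNormalDensity α s = 1 := by
    rw [h, Nat.cast_zero, zero_add, Gamma_one_half_eq]; field_simp
  have m1 : ∫ s, s ^ 1 * halfNormalDensity α s = α * √2 / √π := by
    rw [h, Nat.cast_one, one_add_one_eq_two, div_self two_ne_zero, Gamma_one]; ring
  have m2 : ∫ s, s ^ 2 * halfNormalDensity α s = α ^ 2 := by
    rw [h, Nat.cast_ofNat, hG3, h2]; field_simp
  have m3 : ∫ s, s ^ 3 * halfNormalDensity α s = 2 * α ^ 3 * √2 / √π := by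
    rw [h, Nat.cast_ofNat, show ((3 : ℝ) + 1) / 2 = 2 by norm_num, Gamma_two, h2']; ring
  have hi := integrable_pow_mul_halfNormalDensity hα
  have hs : π = √π ^ 2 := hπ.symm
  refine ⟨by simpa using m0, ?_, ?_, ?_⟩ <;>
    rw [integral_sub_pow_mul _ fun j _ ↦ hi j] <;>
    simp only [Finset.sum_range_succ, Finset.sum_range_zero, m0, m1, m2, m3,
      sqrt_div zero_le_two] <;>
    norm_num [Nat.choose]
  · ring
  all_goals
    rw [hs]
    field_simp
    ring_nf
    simp only [h2, sqrt_sq hπ0.le]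
    ring

lemma integral_sub_pow_mul_asymLaplaceDensity {p : ℝ} (hp : p ∈ Ioo (0 : ℝ) 1) :
    (∫ e, (e - (1 - 2 * p) / (p * (1 - p))) ^ 0 * asymLaplaceDensity p e = 1) ∧
    (∫ e, (e - (1 - 2 * p) / (p * (1 - p))) ^ 1 * asymLaplaceDensity p e = 0) ∧
    (∫ e, (e - (1 - 2 * p) / (p * (1 - p))) ^ 2 * asymLaplaceDensity p e =
      (1 - 2 * p + 2 * p ^ 2) / (p ^ 2 * (1 - p) ^ 2)) ∧
    (∫ e, (e - (1 - 2 * p) / (p * (1 - p))) ^ 3 * asymLaplaceDensity p e =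
      2 * ((1 - p) ^ 3 - p ^ 3) / (p ^ 3 * (1 - p) ^ 3)) := by
  have hp0 : p ≠ 0 := hp.1.ne'
  have hp1 : 1 - p ≠ 0 := (sub_pos.2 hp.2).ne'
  refine ⟨?_, ?_, ?_, ?_⟩ <;>
  · rw [integral_sub_pow_mul _ fun j _ ↦ integrable_pow_mul_asymLaplaceDensity hp j]
    simp only [Finset.sum_range_succ, Finset.sum_range_zero,
      integral_pow_mul_asymLaplaceDensity hp]
    norm_num [Nat.choose, Nat.factorial]
    field_simp
    ring

/-- The skewness of the GAL distribution does not depend on μ or σ. -/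
theorem gal_skewness (μ σ p α : ℝ) (hσ : 0 < σ) (hp : p ∈ Set.Ioo (0 : ℝ) 1)
    (hα : 0 < α) :
    (∫ y : ℝ,
        (y - (μ + Real.sqrt (2 / Real.pi) * α * σ + σ * (1 - 2 * p) / (p * (1 - p)))) ^ 3 *
          galPdf μ σ p α y) /
      (∫ y : ℝ,
        (y - (μ + Real.sqrt (2 / Real.pi) * α * σ + σ * (1 - 2 * p) / (p * (1 - p)))) ^ 2 *
          galPdf μ σ p α y) ^ ((3 : ℝ) / 2) =
      (α ^ 3 * Real.sqrt (2 / Real.pi) * (4 / Real.pi - 1) +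
          2 * ((1 - p) ^ 3 - p ^ 3) / (p ^ 3 * (1 - p) ^ 3)) /
        (α ^ 2 * (1 - 2 / Real.pi) +
          (1 - 2 * p + 2 * p ^ 2) / (p ^ 2 * (1 - p) ^ 2)) ^ ((3 : ℝ) / 2) := by
  have h := integral_sub_pow_mul_galPdf μ hσ hp hα (√(2 / π) * α) ((1 - 2 * p) / (p * (1 - p)))
  obtain ⟨k0, k1, k2, k3⟩ := integral_sub_pow_mul_halfNormalDensity hα
  obtain ⟨a0, a1, a2, a3⟩ := integral_sub_pow_mul_asymLaplaceDensity hp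
  rw [mul_div_assoc σ, h, h]
  simp only [Finset.sum_range_succ, Finset.sum_range_zero, Nat.sub_zero, Nat.sub_self,
    Nat.reduceSub, k0, k1, k2, k3, a0, a1, a2, a3]
  simp only [zero_mul, mul_zero, one_mul, mul_one, zero_add, add_zero, Nat.choose_zero_right,
    Nat.choose_self, Nat.cast_one]
  have hD : 0 ≤ (1 - 2 * p + 2 * p ^ 2) / (p ^ 2 * (1 - p) ^ 2) + α ^ 2 * (1 - 2 / π) := by
    have h1 : 0 ≤ 1 - 2 / π := sub_nonneg.2 ((div_le_one pi_pos).2 two_le_pi)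
    have h2 : 0 ≤ 1 - 2 * p + 2 * p ^ 2 := by nlinarith [sq_nonneg (1 - p), sq_nonneg p]
    positivity
  have hσ3 : (σ ^ 2) ^ ((3 : ℝ) / 2) = σ ^ 3 := by
    rw [← rpow_natCast, ← rpow_mul hσ.le, ← rpow_natCast]
    norm_num
  rw [mul_rpow (sq_nonneg σ) hD, hσ3, mul_div_mul_left _ _ (pow_ne_zero 3 hσ.ne'), add_comm,
    add_comm (α ^ 2 * (1 - 2 / π))]
end
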